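/- arXiv:2303.13923 — 4 statements merged into one kernel-verified Lean document; each statement's English description precedes it below -/
import Mathlib

section
/- Any two cubic graphs on the same number 2n of vertices (n ≥ 1) can be transformed into one another by a finite sequence of Whitehead moves; that is, the relation 'related by a finite sequence of Whitehead moves' has a single equivalence class on the set of isomorphism classes of cubic graphs on 2n vertices. -/
/-! Cubic multigraphs in the dart (half-edge) model, Whitehead moves,
and the "graph of graphs" `Γ_n`. -/

/-- A cubic multigraph on the `2 * n` vertices `Fin (2 * n)`, in the dart (half-edge) model:
darts are `Fin (6 * n)`, `dinv` is the fixed-point-free involution exchanging the two darts of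
each edge, and `vert` assigns to each dart its base vertex.  Loops and multiple edges are
allowed; `regular` says every vertex carries exactly three darts. -/
structure CubicGraph (n : ℕ) where
  vert : Fin (6 * n) → Fin (2 * n)
  dinv : Fin (6 * n) → Fin (6 * n)
  dinv_invol : ∀ d, dinv (dinv d) = d
  dinv_ne : ∀ d, dinv d ≠ d
  regular : ∀ v : Fin (2 * n), (Finset.univ.filter fun d => vert d = v).card = 3

namespace CubicGraph

variable {n : ℕ}

/-- Two darts are joined if they can be connected by a chain of
"same vertex" / "other half of the same edge" steps. -/
def Reach (g : CubicGraph n) : Fin (6 * n) → Fin (6 * n) → Prop :=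
  Relation.ReflTransGen fun a b => g.vert a = g.vert b ∨ g.dinv a = b

/-- Connectivity of a cubic multigraph. -/
def Connected (g : CubicGraph n) : Prop := ∀ d d', g.Reach d d'

/-- The edge of the dart `d` is a loop. -/
def IsLoop (g : CubicGraph n) (d : Fin (6 * n)) : Prop := g.vert (g.dinv d) = g.vert d

instance (g : CubicGraph n) (d : Fin (6 * n)) : Decidable (g.IsLoop d) :=
  inferInstanceAs (Decidable (_ = _))

lemma card_filter_comp_swap (g : CubicGraph n) (q r : Fin (6 * n)) (v : Fin (2 * n)) :
    (Finset.univ.filter fun d => g.vert (Equiv.swap q r d) = v).card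
      = (Finset.univ.filter fun d => g.vert d = v).card := by
  refine Finset.card_bij (fun d _ => Equiv.swap q r d) ?_ ?_ ?_
  · intro a ha
    simp only [Finset.mem_filter, Finset.mem_univ, true_and] at ha ⊢
    exact ha
  · intro a _ b _ h
    exact (Equiv.swap q r).injective h
  · intro b hb
    simp only [Finset.mem_filter, Finset.mem_univ, true_and] at hb
    exact ⟨Equiv.swap q r b, by simp [hb], by simp⟩

/-- Exchange the base vertices of the two darts `q` and `r`, keeping everything else. -/
def swapDarts (g : CubicGraph n) (q r : Fin (6 * n)) : CubicGraph n where
  vert := fun d => g.vert (Equiv.swap q r d)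
  dinv := g.dinv
  dinv_invol := g.dinv_invol
  dinv_ne := g.dinv_ne
  regular := fun v => (g.card_filter_comp_swap q r v).trans (g.regular v)

/-- The darts based at the same vertex as `x`, other than `x` itself. -/
def othersAt (g : CubicGraph n) (x : Fin (6 * n)) : Finset (Fin (6 * n)) :=
  (Finset.univ.filter fun d => g.vert d = g.vert x).erase x

lemma othersAt_nonempty (g : CubicGraph n) (x : Fin (6 * n)) :
    (g.othersAt x).Nonempty := by
  have hx : x ∈ Finset.univ.filter fun d => g.vert d = g.vert x := by simp
  have h : (g.othersAt x).card = 2 := by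
    rw [othersAt, Finset.card_erase_of_mem hx, g.regular]
  rw [← Finset.card_pos, h]
  norm_num

def oMin (g : CubicGraph n) (x : Fin (6 * n)) : Fin (6 * n) :=
  (g.othersAt x).min' (g.othersAt_nonempty x)

def oMax (g : CubicGraph n) (x : Fin (6 * n)) : Fin (6 * n) :=
  (g.othersAt x).max' (g.othersAt_nonempty x)

/-- The two Whitehead moves (indexed by `i : Fin 2`) performed on the edge containing the dart
`x`.  On a loop the move leaves the graph unchanged; on a non-loop edge the two darts at the
endpoints of the edge other than the edge's own darts are re-attached in one of the two
possible new ways (realized by transporting one dart from each endpoint to the other). -/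
def wh (g : CubicGraph n) (i : Fin 2) (x : Fin (6 * n)) : CubicGraph n :=
  if g.IsLoop x then g
  else if i = 0 then g.swapDarts (g.oMax x) (g.oMin (g.dinv x))
  else g.swapDarts (g.oMax x) (g.oMax (g.dinv x))

/-- An isomorphism of cubic multigraphs: a bijection of darts together with a compatible
bijection of vertices, commuting with the edge involutions. -/
structure Iso (g₁ g₂ : CubicGraph n) where
  dartEquiv : Fin (6 * n) ≃ Fin (6 * n)
  vertEquiv : Fin (2 * n) ≃ Fin (2 * n)
  map_dinv : ∀ d, g₂.dinv (dartEquiv d) = dartEquiv (g₁.dinv d)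
  map_vert : ∀ d, g₂.vert (dartEquiv d) = vertEquiv (g₁.vert d)

def IsIsomorphic (g₁ g₂ : CubicGraph n) : Prop := Nonempty (Iso g₁ g₂)

/-- Reachability avoiding the edge of the dart `x` (i.e. in the graph with that edge removed). -/
def ReachAvoiding (g : CubicGraph n) (x : Fin (6 * n)) :
    Fin (6 * n) → Fin (6 * n) → Prop :=
  Relation.ReflTransGen fun a b =>
    g.vert a = g.vert b ∨ (g.dinv a = b ∧ a ≠ x ∧ a ≠ g.dinv x)

/-- The edge of `x` is a bridge: removing it disconnects the graph. -/
def IsBridge (g : CubicGraph n) (x : Fin (6 * n)) : Prop :=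
  ¬ ∀ d d', g.ReachAvoiding x d d'

/-- A (connected) graph is bridged if it has at least one bridge. -/
def Bridged (g : CubicGraph n) : Prop := ∃ x, g.IsBridge x

/-- A graph is bridgeless if it has no bridge. -/
def Bridgeless (g : CubicGraph n) : Prop := ∀ x, ¬ g.IsBridge x

/-- `c` lists consecutive darts of a cycle of length `k`: the vertices visited are pairwise
distinct, the end of each dart's edge is the base of the next one (cyclically), and the `k`
edges used are pairwise distinct. -/
def IsCycle (g : CubicGraph n) (k : ℕ) (c : Fin k → Fin (6 * n)) : Prop :=
  (∀ i : Fin k,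
    g.vert (g.dinv (c i)) = g.vert (c ⟨(i.1 + 1) % k, Nat.mod_lt _ i.pos⟩)) ∧
  Function.Injective (fun i => g.vert (c i)) ∧
  ∀ i j : Fin k, c j ≠ g.dinv (c i)

/-- The cycle `c` is indecomposable (induced): no edge of `g` other than the cycle's own
edges joins two vertices of the cycle. -/
def Indecomposable (g : CubicGraph n) (k : ℕ) (c : Fin k → Fin (6 * n)) : Prop :=
  ∀ d, (∃ i, g.vert d = g.vert (c i)) → (∃ j, g.vert (g.dinv d) = g.vert (c j)) →
    ∃ i, d = c i ∨ d = g.dinv (c i)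

/-- The girth: the least length of a cycle. -/
noncomputable def girth (g : CubicGraph n) : ℕ :=
  sInf {k | 0 < k ∧ ∃ c : Fin k → Fin (6 * n), g.IsCycle k c}

/-- The only cycles of the graph are loops. -/
def OnlyLoopCycles (g : CubicGraph n) : Prop :=
  ∀ k, 2 ≤ k → ∀ c : Fin k → Fin (6 * n), ¬ g.IsCycle k c

/-- The number of darts lying on loops (each loop contributes two darts). -/
def loopCount (g : CubicGraph n) : ℕ :=
  (Finset.univ.filter fun d => g.IsLoop d).card

end CubicGraph

instance {n : ℕ} : Finite (CubicGraph n) := by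
  have hinj : Function.Injective fun g : CubicGraph n => (g.vert, g.dinv) := by
    rintro ⟨v₁, i₁, _, _, _⟩ ⟨v₂, i₂, _, _, _⟩ h
    simp only [Prod.mk.injEq] at h
    obtain ⟨h₁, h₂⟩ := h
    subst h₁; subst h₂; rfl
  exact Finite.of_injective _ hinj

/-- Isomorphism of connected cubic graphs. -/
def cgIso {n : ℕ} (g₁ g₂ : {g : CubicGraph n // g.Connected}) : Prop :=
  CubicGraph.IsIsomorphic g₁.1 g₂.1

/-- The vertex set of the graph of graphs `Γ_n`: isomorphism classes of connected cubic
multigraphs on `2 * n` vertices. -/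
abbrev GammaV (n : ℕ) := Quot (@cgIso n)

/-- The number of directed edges of `Γ_n` from the class `u` to the class `v`: one edge for
each Whitehead move of a representative of `u` whose result lies in the class `v`.  A move
specification is a pair `(i, x)` of a move type `i : Fin 2` and a dart `x`; each of the two
Whitehead moves of each edge is counted by exactly two specifications (one for each of the
two darts of the edge), whence the division by `2`. -/
noncomputable def edgeMult (n : ℕ) (u v : GammaV n) : ℕ :=
  Nat.card {p : Fin 2 × Fin (6 * n) //
    CubicGraph.IsIsomorphic ((Quot.out u).1.wh p.1 p.2) (Quot.out v).1} / 2

/-- The sum of out-degrees of the classes in `S` (every class has out-degree `6 * n`: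
two Whitehead moves for each of the `3 * n` edges). -/
noncomputable def dOut (n : ℕ) (S : Set (GammaV n)) : ℕ :=
  Nat.card {q : GammaV n × Fin 2 × Fin (6 * n) // q.1 ∈ S} / 2

/-- The number of directed edges of `Γ_n` from `S` to its complement. -/
noncomputable def boundaryCount (n : ℕ) (S : Set (GammaV n)) : ℕ :=
  Nat.card {q : GammaV n × Fin 2 × Fin (6 * n) // q.1 ∈ S ∧
    ∀ v : GammaV n,
      CubicGraph.IsIsomorphic ((Quot.out q.1).1.wh q.2.1 q.2.2) (Quot.out v).1 → v ∉ S} / 2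

/-- The outer conductance of a set `S` of vertices of `Γ_n`. -/
noncomputable def phiOutSet (n : ℕ) (S : Set (GammaV n)) : ℝ :=
  (boundaryCount n S : ℝ) / min (dOut n S : ℝ) (dOut n Sᶜ : ℝ)

/-- The outer conductance of `Γ_n`: the infimum of the outer conductances of nonempty
proper subsets of vertices. -/
noncomputable def phiOut (n : ℕ) : ℝ :=
  sInf {x : ℝ | ∃ S : Set (GammaV n), S.Nonempty ∧ Sᶜ.Nonempty ∧ x = phiOutSet n S}

/-- The set of classes of bridged cubic graphs. -/
def bridgedSet (n : ℕ) : Set (GammaV n) := {u | (Quot.out u).1.Bridged}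

namespace CubicGraph

variable {n : ℕ}

@[ext]
lemma ext_vert_dinv {g h : CubicGraph n} (hv : g.vert = h.vert) (hd : g.dinv = h.dinv) : g = h := by
  cases g; cases h; simp_all

lemma IsIsomorphic.refl (g : CubicGraph n) : IsIsomorphic g g :=
  ⟨⟨Equiv.refl _, Equiv.refl _, fun _ => rfl, fun _ => rfl⟩⟩

lemma IsIsomorphic.trans {g h k : CubicGraph n} (e : IsIsomorphic g h) (f : IsIsomorphic h k) :
    IsIsomorphic g k := by
  obtain ⟨e⟩ := e
  obtain ⟨f⟩ := f
  exact ⟨⟨e.dartEquiv.trans f.dartEquiv, e.vertEquiv.trans f.vertEquiv,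
    fun d => by simp [f.map_dinv, e.map_dinv], fun d => by simp [f.map_vert, e.map_vert]⟩⟩

lemma IsIsomorphic.symm {g h : CubicGraph n} (e : IsIsomorphic g h) : IsIsomorphic h g := by
  obtain ⟨e⟩ := e
  refine ⟨⟨e.dartEquiv.symm, e.vertEquiv.symm, fun d => ?_, fun d => ?_⟩⟩
  · rw [Equiv.eq_symm_apply, ← e.map_dinv, Equiv.apply_symm_apply]
  · rw [Equiv.eq_symm_apply, ← e.map_vert, Equiv.apply_symm_apply]

lemma IsIsomorphic.connected {g h : CubicGraph n} (e : IsIsomorphic g h) (hg : g.Connected) :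
    h.Connected := by
  obtain ⟨e⟩ := e
  intro d d'
  suffices ∀ a b, g.Reach a b → h.Reach (e.dartEquiv a) (e.dartEquiv b) by
    simpa using this _ _ (hg (e.dartEquiv.symm d) (e.dartEquiv.symm d'))
  intro a b hab
  induction hab with
  | refl => exact .refl
  | tail _ s ih =>
    refine Relation.ReflTransGen.tail ih (s.imp (fun s => ?_) fun s => ?_)
    · rw [e.map_vert, e.map_vert, s]
    · rw [e.map_dinv, s]

/-- One Whitehead move, up to isomorphism of the result. -/
def Step (a b : CubicGraph n) : Prop :=
  ∃ (i : Fin 2) (x : Fin (6 * n)), IsIsomorphic (a.wh i x) b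

lemma Step.trans_iso {a b c : CubicGraph n} (h : Step a b) (e : IsIsomorphic b c) : Step a c := by
  obtain ⟨i, x, h⟩ := h
  exact ⟨i, x, h.trans e⟩

/-- The darts `q` and `r` are based at the two ends of the edge of `x`, which is not a loop and
contains neither of them. -/
structure Flanks (g : CubicGraph n) (x q r : Fin (6 * n)) : Prop where
  left : g.vert q = g.vert x
  right : g.vert r = g.vert (g.dinv x)
  left_ne : q ≠ x
  right_ne : r ≠ g.dinv x
  not_loop : ¬ g.IsLoop x

lemma mem_othersAt {g : CubicGraph n} {x d : Fin (6 * n)} :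
    d ∈ g.othersAt x ↔ d ≠ x ∧ g.vert d = g.vert x := by
  simp [othersAt]

lemma card_othersAt (g : CubicGraph n) (x : Fin (6 * n)) : (g.othersAt x).card = 2 := by
  rw [othersAt, Finset.card_erase_of_mem (by simp), g.regular]

lemma oMin_mem (g : CubicGraph n) (x : Fin (6 * n)) : g.oMin x ∈ g.othersAt x :=
  Finset.min'_mem _ _

lemma oMax_mem (g : CubicGraph n) (x : Fin (6 * n)) : g.oMax x ∈ g.othersAt x :=
  Finset.max'_mem _ _

lemma oMin_ne_oMax (g : CubicGraph n) (x : Fin (6 * n)) : g.oMin x ≠ g.oMax x :=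
  (Finset.min'_lt_max'_of_card _ (by rw [card_othersAt]; norm_num)).ne

lemma eq_oMin_or_oMax (g : CubicGraph n) {x d : Fin (6 * n)} (hd : d ∈ g.othersAt x) :
    d = g.oMin x ∨ d = g.oMax x := by
  have h : ({g.oMin x, g.oMax x} : Finset _) = g.othersAt x := by
    apply Finset.eq_of_subset_of_card_le
    · intro y hy
      simp only [Finset.mem_insert, Finset.mem_singleton] at hy
      rcases hy with rfl | rfl
      exacts [g.oMin_mem x, g.oMax_mem x]
    · rw [card_othersAt, Finset.card_pair (g.oMin_ne_oMax x)]
  simpa [← h] using hd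

lemma flanks_of_mem {g : CubicGraph n} {x q r : Fin (6 * n)} (hx : ¬ g.IsLoop x)
    (hq : q ∈ g.othersAt x) (hr : r ∈ g.othersAt (g.dinv x)) : g.Flanks x q r := by
  rw [mem_othersAt] at hq hr
  exact ⟨hq.2, hr.2, hq.1, hr.1, hx⟩

lemma eq_of_vert_eq (g : CubicGraph n) {x a b : Fin (6 * n)} (ha : g.vert a = g.vert x)
    (hb : g.vert b = g.vert x) (hax : a ≠ x) (hbx : b ≠ x) (hab : a ≠ b) (y : Fin (6 * n))
    (hy : g.vert y = g.vert x) : y = x ∨ y = a ∨ y = b := by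
  rcases eq_or_ne y x with rfl | hyx
  · exact .inl rfl
  have h1 := g.eq_oMin_or_oMax (mem_othersAt.2 ⟨hax, ha⟩)
  have h2 := g.eq_oMin_or_oMax (mem_othersAt.2 ⟨hbx, hb⟩)
  have h3 := g.eq_oMin_or_oMax (mem_othersAt.2 ⟨hyx, hy⟩)
  grind

/-- Exchanging one pair of flanking darts is, up to isomorphism, the same as exchanging the
complementary pair. -/
lemma Flanks.swapDarts_iso {g : CubicGraph n} {x a b c d : Fin (6 * n)}
    (hac : g.Flanks x a c) (hbd : g.Flanks x b d) (hab : a ≠ b) (hcd : c ≠ d) :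
    IsIsomorphic (g.swapDarts b d) (g.swapDarts a c) := by
  obtain ⟨ha, hc, hax, hcx, hl⟩ := hac
  obtain ⟨hb, hd, hbx, hdx, -⟩ := hbd
  have hl : g.vert (g.dinv x) ≠ g.vert x := hl
  have only_left := g.eq_of_vert_eq ha hb hax hbx hab
  have only_right := g.eq_of_vert_eq hc hd hcx hdx hcd
  refine ⟨⟨Equiv.swap x (g.dinv x), Equiv.swap (g.vert x) (g.vert (g.dinv x)), fun y => ?_,
    fun y => ?_⟩⟩
  · simp only [swapDarts, Equiv.swap_apply_def]
    have := g.dinv_invol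
    have := g.dinv_ne
    grind
  · simp only [swapDarts, Equiv.swap_apply_def]
    grind

lemma Flanks.step {g : CubicGraph n} {x q r : Fin (6 * n)} (h : g.Flanks x q r) :
    Step g (g.swapDarts q r) := by
  have hx := h.not_loop
  have hq := g.eq_oMin_or_oMax (mem_othersAt.2 ⟨h.left_ne, h.left⟩)
  have hr := g.eq_oMin_or_oMax (mem_othersAt.2 ⟨h.right_ne, h.right⟩)
  have h00 := flanks_of_mem hx (g.oMin_mem x) (g.oMin_mem (g.dinv x))
  have h01 := flanks_of_mem hx (g.oMin_mem x) (g.oMax_mem (g.dinv x))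
  have h10 := flanks_of_mem hx (g.oMax_mem x) (g.oMin_mem (g.dinv x))
  have h11 := flanks_of_mem hx (g.oMax_mem x) (g.oMax_mem (g.dinv x))
  have n1 := g.oMin_ne_oMax x
  have n2 := g.oMin_ne_oMax (g.dinv x)
  rcases hq with rfl | rfl <;> rcases hr with rfl | rfl
  · exact ⟨1, x, by simpa [wh, hx] using h00.swapDarts_iso h11 n1 n2⟩
  · exact ⟨0, x, by simpa [wh, hx] using h01.swapDarts_iso h10 n1 n2.symm⟩
  · exact ⟨0, x, by simpa [wh, hx] using IsIsomorphic.refl _⟩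
  · exact ⟨1, x, by simpa [wh, hx] using IsIsomorphic.refl _⟩

lemma swapDarts_swapDarts (g : CubicGraph n) (q r : Fin (6 * n)) :
    (g.swapDarts q r).swapDarts q r = g := by
  ext1
  · funext d; simp [swapDarts]
  · rfl

lemma Flanks.ne {g : CubicGraph n} {x q r : Fin (6 * n)} (h : g.Flanks x q r) :
    g.vert q ≠ g.vert r := by
  rw [h.left, h.right]
  exact fun e => h.not_loop e.symm

lemma Flanks.swapDarts_vert {g : CubicGraph n} {x q r : Fin (6 * n)} (h : g.Flanks x q r) :
    (g.swapDarts q r).vert x = g.vert x ∧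
      (g.swapDarts q r).vert (g.dinv x) = g.vert (g.dinv x) := by
  have hne := h.ne
  obtain ⟨h1, h2, h3, h4, h5⟩ := h
  constructor
  · have : x ≠ r := by rintro rfl; exact hne h1
    simp [swapDarts, Equiv.swap_apply_of_ne_of_ne h3.symm this]
  · have : g.dinv x ≠ q := by rintro rfl; exact hne h2.symm
    simp [swapDarts, Equiv.swap_apply_of_ne_of_ne this h4.symm]

lemma Flanks.swapDarts {g : CubicGraph n} {x q r : Fin (6 * n)} (h : g.Flanks x q r) :
    (g.swapDarts q r).Flanks (g.dinv x) q r := by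
  have hd : (g.swapDarts q r).dinv = g.dinv := rfl
  have hne := h.ne
  obtain ⟨v1, v2⟩ := h.swapDarts_vert
  obtain ⟨h1, h2, h3, h4, h5⟩ := h
  refine ⟨?_, ?_, ?_, ?_, ?_⟩
  · rw [v2, ← h2]; simp [CubicGraph.swapDarts]
  · rw [hd, g.dinv_invol, v1, ← h1]; simp [CubicGraph.swapDarts]
  · rintro rfl; exact hne h2.symm
  · rw [hd, g.dinv_invol]; rintro rfl; exact hne h1
  · rw [IsLoop, v2, hd, g.dinv_invol, v1]; exact fun e => h5 e.symm

/-- `b` is obtained from `a` by finitely many Whitehead moves, up to isomorphism. -/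
def Rel : CubicGraph n → CubicGraph n → Prop := Relation.ReflTransGen Step

lemma IsIsomorphic.rel (hn : 1 ≤ n) {g h : CubicGraph n} (e : IsIsomorphic g h) : Rel g h := by
  let x : Fin (6 * n) := ⟨0, by omega⟩
  by_cases hx : g.IsLoop x
  · exact .single ⟨0, x, by simpa [wh, hx] using e⟩
  · have f := flanks_of_mem hx (g.oMax_mem x) (g.oMin_mem (g.dinv x))
    refine .head f.step (.single (f.swapDarts.step.trans_iso ?_))
    rwa [swapDarts_swapDarts]

lemma Rel.symm (hn : 1 ≤ n) {g h : CubicGraph n} (r : Rel g h) : Rel h g := by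
  induction r with
  | refl => exact .refl
  | tail _ s ih =>
    refine Relation.ReflTransGen.trans ?_ ih
    obtain ⟨i, x, e⟩ := s
    refine (e.symm.rel hn).trans ?_
    unfold wh
    split_ifs with hx
    · exact .refl
    · have f := (flanks_of_mem hx (oMax_mem _ x) (oMin_mem _ _)).swapDarts.step
      rw [swapDarts_swapDarts] at f
      exact .single f
    · have f := (flanks_of_mem hx (oMax_mem _ x) (oMax_mem _ _)).swapDarts.step
      rw [swapDarts_swapDarts] at f
      exact .single f

lemma Reach.symm {g : CubicGraph n} {a b : Fin (6 * n)} (h : g.Reach a b) : g.Reach b a := by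
  induction h with
  | refl => exact .refl
  | tail _ s ih =>
    refine Relation.ReflTransGen.head (s.imp Eq.symm fun s => ?_) ih
    rw [← s, g.dinv_invol]

lemma Flanks.connected {g : CubicGraph n} {x q r : Fin (6 * n)} (h : g.Flanks x q r)
    (hg : g.Connected) : (g.swapDarts q r).Connected := by
  obtain ⟨v1, v2⟩ := h.swapDarts_vert
  have hqr : (g.swapDarts q r).Reach q r := by
    refine .head (b := g.dinv x) (.inl ?_) (.head (b := x) (.inr (g.dinv_invol x))
      (.single (.inl ?_)))
    · rw [v2, ← h.right]; simp [CubicGraph.swapDarts]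
    · rw [v1, ← h.left]; simp [CubicGraph.swapDarts]
  have hs : ∀ a, (g.swapDarts q r).Reach (Equiv.swap q r a) a := by
    intro a
    rw [Equiv.swap_apply_def]
    split_ifs with h1 h2
    · exact h1 ▸ hqr.symm
    · exact h2 ▸ hqr
    · exact .refl
  intro d d'
  have hr : g.Reach d d' := hg d d'
  induction hr with
  | refl => exact .refl
  | @tail b c _ hbc ih =>
    refine Relation.ReflTransGen.trans ih ?_
    rcases hbc with hbc | hbc
    · refine (hs b).symm.trans (.trans (.single (.inl ?_)) (hs c))
      simpa [CubicGraph.swapDarts] using hbc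
    · exact .single (.inr hbc)

/-- Fixed-point-free involutions of the darts. -/
abbrev DartInv (n : ℕ) :=
  {α : Fin (6 * n) → Fin (6 * n) // (∀ d, α (α d) = d) ∧ ∀ d, α d ≠ d}

/-- The cubic graph whose vertex `v` carries the darts `3 * v`, `3 * v + 1` and `3 * v + 2`. -/
def ofInv (α : DartInv n) : CubicGraph n where
  vert d := ⟨d / 3, by omega⟩
  dinv := α.1
  dinv_invol := α.2.1
  dinv_ne := α.2.2
  regular v := by
    have : (Finset.univ.filter fun d : Fin (6 * n) => (⟨d / 3, by omega⟩ : Fin (2 * n)) = v)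
        = {⟨3 * v, by omega⟩, ⟨3 * v + 1, by omega⟩, ⟨3 * v + 2, by omega⟩} := by
      ext d
      simp only [Finset.mem_filter, Finset.mem_univ, true_and, Finset.mem_insert,
        Finset.mem_singleton, Fin.ext_iff]
      omega
    rw [this]
    simp [Finset.card_insert_of_notMem]

lemma ofInv_vert_eq {α : DartInv n} {a b : Fin (6 * n)} :
    (ofInv α).vert a = (ofInv α).vert b ↔ (a : ℕ) / 3 = b / 3 := by
  simp [ofInv]

/-- Conjugate a fixed-point-free involution by a permutation of the darts. -/
def conj (σ : Equiv.Perm (Fin (6 * n))) (α : DartInv n) : DartInv n :=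
  ⟨fun d => σ (α.1 (σ.symm d)), fun d => by simp [α.2.1], fun d => by
    rw [Ne, ← Equiv.eq_symm_apply]; exact α.2.2 _⟩

lemma conj_apply (σ : Equiv.Perm (Fin (6 * n))) (α : DartInv n) (d : Fin (6 * n)) :
    (conj σ α).1 d = σ (α.1 (σ.symm d)) := rfl

lemma exists_iso_ofInv (g : CubicGraph n) : ∃ α, IsIsomorphic g (ofInv α) := by
  have fib : ∀ v, Nonempty ({d // g.vert d = v} ≃ Fin 3) := fun v =>
    ⟨Fintype.equivFinOfCardEq (by rw [Fintype.card_subtype, g.regular])⟩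
  let e : Fin (6 * n) ≃ Fin (6 * n) :=
    (Equiv.sigmaFiberEquiv g.vert).symm.trans <|
      (Equiv.sigmaCongrRight fun v => (fib v).some).trans <|
      (Equiv.sigmaEquivProd _ _).trans <| finProdFinEquiv.trans (finCongr (by ring))
  have he : ∀ d, (e d : ℕ) / 3 = g.vert d := by
    intro d
    simp only [e, Equiv.trans_apply, finCongr_apply, Fin.val_cast, finProdFinEquiv_apply_val]
    simp [Equiv.sigmaFiberEquiv]
    omega
  refine ⟨⟨fun d => e (g.dinv (e.symm d)), fun d => by simp [g.dinv_invol], fun d => by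
    rw [Ne, ← Equiv.eq_symm_apply]; exact g.dinv_ne _⟩,
    ⟨⟨e, Equiv.refl _, fun d => ?_, fun d => ?_⟩⟩⟩
  · simp [ofInv]
  · simp [ofInv, he]

/-- `ofInv β` is obtained from `ofInv α` by Whitehead moves, and is connected if `ofInv α` is. -/
def InvRel (α β : DartInv n) : Prop :=
  Rel (ofInv α) (ofInv β) ∧ ((ofInv α).Connected → (ofInv β).Connected)

lemma InvRel.refl (α : DartInv n) : InvRel α α := ⟨.refl, id⟩

lemma InvRel.trans {α β γ : DartInv n} (h : InvRel α β) (h' : InvRel β γ) : InvRel α γ :=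
  ⟨h.1.trans h'.1, h'.2 ∘ h.2⟩

/-- Relabelling the darts by a permutation that induces a permutation of the vertices. -/
lemma invRel_conj_of_vert (hn : 1 ≤ n) (α : DartInv n) (σ : Equiv.Perm (Fin (6 * n)))
    (τ : Equiv.Perm (Fin (2 * n)))
    (h : ∀ d, (ofInv α).vert (σ d) = τ ((ofInv α).vert d)) : InvRel α (conj σ α) := by
  have e : IsIsomorphic (ofInv α) (ofInv (conj σ α)) :=
    ⟨⟨σ, τ, fun d => by simp [ofInv, conj_apply], h⟩⟩
  exact ⟨e.rel hn, e.connected⟩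

lemma invRel_conj_swap_of_vert_eq (hn : 1 ≤ n) (α : DartInv n) {a b : Fin (6 * n)}
    (h : (a : ℕ) / 3 = b / 3) : InvRel α (conj (Equiv.swap a b) α) := by
  refine invRel_conj_of_vert hn α _ (Equiv.refl _) fun d => ?_
  rw [Equiv.refl_apply, ofInv_vert_eq, Equiv.swap_apply_def]
  split_ifs with h1 h2
  · rw [h1, h]
  · rw [h2, h]
  · rfl

lemma Flanks.invRel {α : DartInv n} {x q r : Fin (6 * n)}
    (h : (ofInv α).Flanks x q r) : InvRel α (conj (Equiv.swap q r) α) := by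
  have e : IsIsomorphic ((ofInv α).swapDarts q r) (ofInv (conj (Equiv.swap q r) α)) :=
    ⟨⟨Equiv.swap q r, Equiv.refl _, fun d => by simp [ofInv, conj_apply, CubicGraph.swapDarts],
      fun d => rfl⟩⟩
  exact ⟨.single (h.step.trans_iso e), fun hc => e.connected (h.connected hc)⟩

/-- The vertices `0, 1, …, k` form a path whose edges join the darts `3 * i + 2` and
`3 * i + 3`. -/
def HasPath (k : ℕ) (α : DartInv n) : Prop :=
  ∀ a b : Fin (6 * n), (a : ℕ) % 3 = 2 → (b : ℕ) = a + 1 → (a : ℕ) < 3 * k → α.1 a = b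

/-- The darts at the vertices `0, 1, …, k` that do not lie on the edges of the path. -/
def IsLeaf (k : ℕ) (a : Fin (6 * n)) : Prop :=
  ((a : ℕ) % 3 = 1 ∧ (a : ℕ) ≤ 3 * k + 1) ∨ (a : ℕ) = 0 ∨ (a : ℕ) = 3 * k + 2

/-- Exchanging the darts `a` and `b` of a path is realized by Whitehead moves. -/
def LeafRel (k : ℕ) (a b : Fin (6 * n)) : Prop :=
  ∀ α : DartInv n, HasPath k α →
    InvRel α (conj (Equiv.swap a b) α) ∧ HasPath k (conj (Equiv.swap a b) α)

lemma LeafRel.refl (k : ℕ) (a : Fin (6 * n)) : LeafRel k a a := by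
  intro α h
  have : conj (Equiv.swap a a) α = α := by
    ext d : 2; simp [conj_apply]
  rw [this]
  exact ⟨.refl α, h⟩

lemma LeafRel.symm {k : ℕ} {a b : Fin (6 * n)} (h : LeafRel k a b) : LeafRel k b a := by
  intro α
  rw [Equiv.swap_comm]
  exact h α

lemma LeafRel.trans {k : ℕ} {a b c : Fin (6 * n)} (hab : LeafRel k a b) (hbc : LeafRel k b c) :
    LeafRel k a c := by
  rcases eq_or_ne a b with rfl | h1
  · exact hbc
  rcases eq_or_ne a c with rfl | h2
  · exact .refl k a
  rcases eq_or_ne b c with rfl | h3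
  · exact hab
  intro α h
  obtain ⟨r1, p1⟩ := hab α h
  obtain ⟨r2, p2⟩ := hbc _ p1
  obtain ⟨r3, p3⟩ := hab _ p2
  have key : ∀ d, Equiv.swap a b (Equiv.swap b c (Equiv.swap a b d)) = Equiv.swap a c d := by
    intro d
    rw [← Equiv.swap_mul_swap_mul_swap h3.symm h2.symm, Equiv.swap_comm b a, Equiv.swap_comm c b]
    rfl
  have : conj (Equiv.swap a b) (conj (Equiv.swap b c) (conj (Equiv.swap a b) α))
      = conj (Equiv.swap a c) α := by
    ext d : 2; simp [conj_apply, key]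
  rw [← this]
  exact ⟨(r1.trans r2).trans r3, p3⟩

lemma HasPath.conj {k : ℕ} {α : DartInv n} (h : HasPath k α) {σ : Equiv.Perm (Fin (6 * n))}
    (h2 : ∀ d : Fin (6 * n), (d : ℕ) % 3 = 2 → (d : ℕ) < 3 * k → σ d = d)
    (h0 : ∀ d : Fin (6 * n), (d : ℕ) % 3 = 0 → 0 < (d : ℕ) → (d : ℕ) ≤ 3 * k → σ d = d) :
    HasPath k (CubicGraph.conj σ α) := by
  intro a b ha hb hk
  rw [conj_apply, σ.symm_apply_eq.2 (h2 a ha hk).symm, h a b ha hb hk]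
  exact h0 b (by omega) (by omega) (by omega)

lemma HasPath.conj_swap {k : ℕ} {α : DartInv n} (h : HasPath k α) {a b : Fin (6 * n)}
    (ha : IsLeaf k a) (hb : IsLeaf k b) : HasPath k (CubicGraph.conj (Equiv.swap a b) α) := by
  unfold IsLeaf at ha hb
  refine h.conj (fun d h1 h2 => ?_) (fun d h1 h2 h3 => ?_) <;>
  · apply Equiv.swap_apply_of_ne_of_ne <;> rintro rfl <;> omega

lemma leafRel_one (hn : 1 ≤ n) {k : ℕ} (hk : k < 2 * n) (i : ℕ) (hi : i ≤ k) :
    LeafRel (n := n) k ⟨1, by omega⟩ ⟨3 * i + 1, by omega⟩ := by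
  induction i with
  | zero => exact .refl _ _
  | succ i ih =>
    refine (ih (by omega)).trans fun α h => ⟨?_, h.conj_swap ?_ ?_⟩
    · have hx := h ⟨3 * i + 2, by omega⟩ ⟨3 * i + 3, by omega⟩ (by simp only; omega) rfl (by simp only; omega)
      have hd : (ofInv α).dinv ⟨3 * i + 2, by omega⟩ = ⟨3 * i + 3, by omega⟩ := hx
      refine Flanks.invRel (x := ⟨3 * i + 2, by omega⟩) ⟨?_, ?_, ?_, ?_, ?_⟩
      · rw [ofInv_vert_eq]; simp only; omega
      · rw [hd, ofInv_vert_eq]; simp only; omega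
      · simp
      · rw [hd]; simp; omega
      · rw [IsLoop, hd, ofInv_vert_eq]; simp only; omega
    · left; simp only; omega
    · left; simp only; omega

lemma IsLeaf.leafRel (hn : 1 ≤ n) {k : ℕ} (hk : k < 2 * n) {a b : Fin (6 * n)}
    (ha : IsLeaf k a) (hb : IsLeaf k b) : LeafRel k a b := by
  have key : ∀ c : Fin (6 * n), IsLeaf k c → LeafRel k ⟨1, by omega⟩ c := by
    intro c hc
    have mid : ∀ (i : ℕ) (hi : i ≤ k), IsLeaf (n := n) k ⟨3 * i + 1, by omega⟩ := by
      intro i hi; left; simp only; omega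
    rcases id hc with ⟨h1, h2⟩ | h | h
    · have := leafRel_one hn hk (c / 3) (by omega)
      convert this using 1
      ext; simp only; omega
    · exact fun α p => ⟨invRel_conj_swap_of_vert_eq hn α (by simp only; omega),
        p.conj_swap (mid 0 (by omega)) hc⟩
    · refine (leafRel_one hn hk k le_rfl).trans fun α p => ⟨invRel_conj_swap_of_vert_eq hn α ?_,
        p.conj_swap (mid k le_rfl) hc⟩
      simp only; omega
  exact (key a ha).symm.trans (key b hb)

lemma HasPath.apply_of_not_isLeaf {k : ℕ} {α : DartInv n} (h : HasPath k α) {d : Fin (6 * n)}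
    (hk : k < 2 * n) (hd : ¬ IsLeaf k d) (hdk : (d : ℕ) < 3 * k + 3) :
    ((d : ℕ) % 3 = 2 ∧ (d : ℕ) < 3 * k ∧ (α.1 d : ℕ) = d + 1) ∨
      ((d : ℕ) % 3 = 0 ∧ (α.1 d : ℕ) + 1 = d) := by
  unfold IsLeaf at hd
  by_cases h2 : (d : ℕ) % 3 = 2
  · left
    refine ⟨h2, by omega, ?_⟩
    rw [h d ⟨d + 1, by omega⟩ h2 rfl (by omega)]
  · right
    refine ⟨by omega, ?_⟩
    have := h ⟨d - 1, by omega⟩ d (by simp only; omega) (by simp only; omega) (by simp only; omega)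
    rw [← this, α.2.1]
    simp only [this]
    omega

/-- Permute the vertices, keeping the order of the three darts at each vertex. -/
lemma exists_vertex_perm (τ : Equiv.Perm (Fin (2 * n))) :
    ∃ σ : Equiv.Perm (Fin (6 * n)), ∀ (d : Fin (6 * n)) (v : Fin (2 * n)), (v : ℕ) = d / 3 → (σ d : ℕ) = 3 * τ v + d % 3 := by
  let E : Fin (2 * n) × Fin 3 ≃ Fin (6 * n) := finProdFinEquiv.trans (finCongr (by ring))
  refine ⟨E.symm.trans ((τ.prodCongr (Equiv.refl _)).trans E), fun d v hv => ?_⟩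
  have hd : E.symm d = (v, ⟨d % 3, by omega⟩) := by
    rw [Equiv.symm_apply_eq]
    ext
    simp [E, hv]
    omega
  rw [Equiv.trans_apply, hd]
  simp [E]
  omega

lemma HasPath.extend (hn : 1 ≤ n) {k : ℕ} (hk : k + 1 < 2 * n) {α : DartInv n} (h : HasPath k α)
    (hc : (ofInv α).Connected) : ∃ β, InvRel α β ∧ HasPath (k + 1) β := by
  obtain ⟨d, hd, hαd⟩ : ∃ d : Fin (6 * n), (d : ℕ) < 3 * k + 3 ∧ 3 * k + 3 ≤ (α.1 d : ℕ) := by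
    by_contra! hcl
    have hr : (ofInv α).Reach ⟨0, by omega⟩ ⟨3 * k + 3, by omega⟩ := hc _ _
    have : ∀ b, (ofInv α).Reach ⟨0, by omega⟩ b → (b : ℕ) < 3 * k + 3 := by
      intro b hb
      induction hb with
      | refl => simp
      | tail _ s ih =>
        rcases s with s | s
        · rw [ofInv_vert_eq] at s; omega
        · rw [← s]; exact hcl _ ih
    exact absurd (this _ hr) (by simp)
  have hleaf : IsLeaf k d := by
    by_contra hl
    have := h.apply_of_not_isLeaf (by omega) hl hd
    omega
  let t : Fin (6 * n) := ⟨3 * k + 2, by omega⟩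
  obtain ⟨r₁, p₁⟩ := hleaf.leafRel hn (by omega) (b := t) (.inr (.inr rfl)) α h
  set α₁ := CubicGraph.conj (Equiv.swap d t) α
  have ht₁ : α₁.1 t = α.1 d := by
    simp only [α₁, conj_apply, Equiv.symm_swap, Equiv.swap_apply_right]
    apply Equiv.swap_apply_of_ne_of_ne
    · exact α.2.2 d
    · simp only [t, Ne, Fin.ext_iff]; omega
  let m : Fin (2 * n) := ⟨α.1 d / 3, by omega⟩
  obtain ⟨σ, hσ⟩ := exists_vertex_perm (n := n) (Equiv.swap m ⟨k + 1, hk⟩)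
  have r₂ : InvRel α₁ (CubicGraph.conj σ α₁) := by
    refine invRel_conj_of_vert hn α₁ σ (Equiv.swap m ⟨k + 1, hk⟩) fun e => ?_
    ext
    have := hσ e ((ofInv α₁).vert e) rfl
    have h' : ((ofInv α₁).vert (σ e) : ℕ) = (σ e : ℕ) / 3 := rfl
    rw [h', this]
    omega
  have fix : ∀ e : Fin (6 * n), (e : ℕ) < 3 * k + 3 → σ e = e := by
    intro e he
    have := hσ e ⟨e / 3, by omega⟩ rfl
    rw [Equiv.swap_apply_of_ne_of_ne] at this
    · ext; rw [this]; simp only; omega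
    · simp only [m, Ne, Fin.ext_iff]; omega
    · simp only [Ne, Fin.ext_iff]; omega
  have p₂ : HasPath k (CubicGraph.conj σ α₁) :=
    p₁.conj (fun e _ _ => fix e (by omega)) (fun e _ _ _ => fix e (by omega))
  set α₂ := CubicGraph.conj σ α₁
  have ht₂ : (α₂.1 t : ℕ) / 3 = k + 1 := by
    have : α₂.1 t = σ (α.1 d) := by
      rw [conj_apply, σ.symm_apply_eq.2 (fix t (by simp only [t]; omega)).symm, ht₁]
    rw [this, hσ (α.1 d) m rfl, Equiv.swap_apply_left]
    simp only; omega
  let f : Fin (6 * n) := ⟨3 * k + 3, by omega⟩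
  have fix' : ∀ e : Fin (6 * n), (e : ℕ) < 3 * k + 3 → Equiv.swap (α₂.1 t) f e = e := by
    intro e he
    apply Equiv.swap_apply_of_ne_of_ne
    · rintro rfl; omega
    · simp only [f, Ne, Fin.ext_iff]; omega
  have r₃ : InvRel α₂ (CubicGraph.conj (Equiv.swap (α₂.1 t) f) α₂) :=
    invRel_conj_swap_of_vert_eq hn α₂ (by simp only [f]; omega)
  have p₃ : HasPath k (CubicGraph.conj (Equiv.swap (α₂.1 t) f) α₂) :=
    p₂.conj (fun e _ _ => fix' e (by omega)) (fun e _ _ _ => fix' e (by omega))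
  refine ⟨_, (r₁.trans r₂).trans r₃, fun a b ha hb hak => ?_⟩
  by_cases hak' : (a : ℕ) < 3 * k
  · exact p₃ a b ha hb hak'
  · have hat : a = t := by ext; simp only [t]; omega
    have hbf : b = f := by ext; simp only [f]; omega
    rw [conj_apply, Equiv.symm_swap, hat, fix' t (by simp only [t]; omega),
      Equiv.swap_apply_left, hbf]

lemma exists_hasPath (hn : 1 ≤ n) {α : DartInv n} (hc : (ofInv α).Connected) (k : ℕ)
    (hk : k < 2 * n) : ∃ β, InvRel α β ∧ HasPath k β := by
  induction k with
  | zero => exact ⟨α, .refl α, fun a b _ _ h => absurd h (by simp)⟩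
  | succ k ih =>
    obtain ⟨β, r, p⟩ := ih (by omega)
    obtain ⟨γ, r', p'⟩ := p.extend hn hk (r.2 hc)
    exact ⟨γ, r.trans r', p'⟩

/-- Two graphs with a Hamiltonian path are related by Whitehead moves. -/
lemma HasPath.invRel (hn : 1 ≤ n) {α β : DartInv n} (hα : HasPath (2 * n - 1) α)
    (hβ : HasPath (2 * n - 1) β) : InvRel α β := by
  induction hN : (Finset.univ.filter fun d => α.1 d ≠ β.1 d).card using Nat.strong_induction_on
    generalizing α with
  | _ N ih =>
    by_cases hαβ : ∃ d, α.1 d ≠ β.1 d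
    · obtain ⟨d, hd⟩ := hαβ
      have leaf : ∀ e, α.1 e ≠ β.1 e → IsLeaf (2 * n - 1) e := by
        intro e he
        by_contra hl
        have h1 := hα.apply_of_not_isLeaf (by omega) hl (by omega)
        have h2 := hβ.apply_of_not_isLeaf (by omega) hl (by omega)
        exact he (Fin.ext (by omega))
      have hα2 := α.2.1
      have hβ2 := β.2.1
      have dp : α.1 (α.1 d) ≠ β.1 (α.1 d) := by grind
      have dq : α.1 (β.1 d) ≠ β.1 (β.1 d) := by grind
      obtain ⟨r, p⟩ := (leaf _ dp).leafRel hn (by omega) (leaf _ dq) α hα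
      refine r.trans (ih _ ?_ p rfl)
      rw [← hN]
      apply Finset.card_lt_card
      rw [Finset.ssubset_iff_of_subset]
      · refine ⟨d, by simpa using hd, ?_⟩
        have h1 := α.2.2 d
        have h2 := β.2.2 d
        rw [Finset.mem_filter, conj_apply, Equiv.symm_swap,
          Equiv.swap_apply_of_ne_of_ne h1.symm h2.symm, Equiv.swap_apply_left]
        simp
      · intro e he
        simp only [Finset.mem_filter, Finset.mem_univ, true_and] at he ⊢
        contrapose! he
        rw [conj_apply, Equiv.symm_swap, Equiv.swap_apply_of_ne_of_ne (a := α.1 d) (x := e),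
          Equiv.swap_apply_of_ne_of_ne, he] <;> grind
    · push Not at hαβ
      rw [show α = β from Subtype.ext (funext hαβ)]
      exact .refl β

end CubicGraph

/-- Any two connected cubic graphs on `2n` vertices (`n ≥ 1`) are related by
a finite sequence of Whitehead moves (performed up to isomorphism at each step): the relation
has a single equivalence class. -/
theorem whitehead_moves_connect (n : ℕ) (hn : 1 ≤ n) (g₁ g₂ : CubicGraph n)
    (h₁ : g₁.Connected) (h₂ : g₂.Connected) :
    Relation.ReflTransGen
      (fun a b : CubicGraph n =>
        ∃ (i : Fin 2) (x : Fin (6 * n)), CubicGraph.IsIsomorphic (a.wh i x) b) g₁ g₂ := by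
  obtain ⟨α₁, e₁⟩ := g₁.exists_iso_ofInv
  obtain ⟨α₂, e₂⟩ := g₂.exists_iso_ofInv
  obtain ⟨β₁, r₁, p₁⟩ := CubicGraph.exists_hasPath hn (e₁.connected h₁) (2 * n - 1) (by omega)
  obtain ⟨β₂, r₂, p₂⟩ := CubicGraph.exists_hasPath hn (e₂.connected h₂) (2 * n - 1) (by omega)
  have l₁ : CubicGraph.Rel g₁ (CubicGraph.ofInv β₁) := (e₁.rel hn).trans r₁.1
  have l₂ : CubicGraph.Rel g₂ (CubicGraph.ofInv β₂) := (e₂.rel hn).trans r₂.1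
  exact (l₁.trans (p₁.invRel hn p₂).1).trans (l₂.symm hn)
end

section
/- Let g be a cubic graph and let C_k be an indecomposable k-cycle in g with k ≥ 2 (an induced cycle subgraph such that no edge of g other than the edges of C_k joins two vertices of C_k). Then there is a Whitehead move on an edge of C_k after which C_k is transformed into an indecomposable (k−1)-cycle, and consequently there is a sequence of k−1 Whitehead moves transforming C_k into a loop. -/
namespace CubicGraph

variable {n : ℕ}

lemma eq_oMin_or_eq_oMax {g : CubicGraph n} {x d : Fin (6 * n)} (hd : d ∈ g.othersAt x) :
    d = g.oMin x ∨ d = g.oMax x := by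
  have hlt : g.oMin x < g.oMax x :=
    Finset.min'_lt_max'_of_card _ (by rw [card_othersAt]; norm_num)
  have heq : ({g.oMin x, g.oMax x} : Finset (Fin (6 * n))) = g.othersAt x := by
    refine Finset.eq_of_subset_of_card_le ?_ ?_
    · intro y hy
      rcases Finset.mem_insert.1 hy with rfl | hy
      · exact g.oMin_mem x
      · rw [Finset.mem_singleton.1 hy]
        exact g.oMax_mem x
    · rw [card_othersAt, Finset.card_pair hlt.ne]
  rw [← heq] at hd
  simpa using hd

/-- Every dart at the far endpoint of a non-loop edge is exchanged with `oMax` by one of the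
two Whitehead moves on that edge. -/
lemma exists_wh_eq_swapDarts {g : CubicGraph n} {x r : Fin (6 * n)} (hx : ¬ g.IsLoop x)
    (hr : r ∈ g.othersAt (g.dinv x)) : ∃ i, g.wh i x = g.swapDarts (g.oMax x) r := by
  rcases eq_oMin_or_eq_oMax hr with rfl | rfl
  · exact ⟨0, by simp [wh, hx]⟩
  · exact ⟨1, by simp [wh, hx]⟩

lemma swapDarts_vert_left (g : CubicGraph n) (q r : Fin (6 * n)) :
    (g.swapDarts q r).vert q = g.vert r := by
  simp [swapDarts]

lemma swapDarts_vert_right (g : CubicGraph n) (q r : Fin (6 * n)) :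
    (g.swapDarts q r).vert r = g.vert q := by
  simp [swapDarts]

lemma swapDarts_vert_of_ne (g : CubicGraph n) {q r d : Fin (6 * n)} (hq : d ≠ q) (hr : d ≠ r) :
    (g.swapDarts q r).vert d = g.vert d := by
  simp [swapDarts, Equiv.swap_apply_of_ne_of_ne hq hr]

lemma dinv_injective (g : CubicGraph n) : Function.Injective g.dinv :=
  Function.Involutive.injective g.dinv_invol

namespace IsCycle

variable {g : CubicGraph n} {m : ℕ} {c : Fin (m + 2) → Fin (6 * n)}

lemma vert_dinv_castSucc (hc : g.IsCycle (m + 2) c) (i : Fin (m + 1)) :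
    g.vert (g.dinv (c i.castSucc)) = g.vert (c i.succ) := by
  rw [hc.1]
  congr 2
  ext
  simp only [Fin.val_castSucc, Fin.val_succ]
  exact Nat.mod_eq_of_lt (by omega)

lemma vert_dinv_last (hc : g.IsCycle (m + 2) c) :
    g.vert (g.dinv (c (Fin.last _))) = g.vert (c 0) := by
  rw [hc.1]
  congr 2
  ext
  simp

lemma vert_dinv_zero (hc : g.IsCycle (m + 2) c) : g.vert (g.dinv (c 0)) = g.vert (c 1) :=
  hc.vert_dinv_castSucc 0

lemma index_eq (hc : g.IsCycle (m + 2) c) {i j : Fin (m + 2)}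
    (h : g.vert (c i) = g.vert (c j)) : i = j :=
  hc.2.1 h

end IsCycle

/-- Dropping the first dart of a cycle leaves a cycle of any graph with the same edges in which
the remaining darts close up and still have distinct base vertices. -/
lemma isCycle_succ {g g' : CubicGraph n} {m : ℕ} {c : Fin (m + 2) → Fin (6 * n)}
    (hc : g.IsCycle (m + 2) c) (hdinv : ∀ d, g'.dinv d = g.dinv d)
    (hstep : ∀ i : Fin m,
      g'.vert (g.dinv (c i.castSucc.succ)) = g'.vert (c i.succ.succ))
    (hlast : g'.vert (g.dinv (c (Fin.last _))) = g'.vert (c 1))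
    (hinj : Function.Injective fun i : Fin (m + 1) => g'.vert (c i.succ)) :
    g'.IsCycle (m + 1) fun i => c i.succ := by
  refine ⟨fun i => ?_, hinj, fun i j => ?_⟩
  · rw [hdinv]
    induction i using Fin.lastCases with
    | last =>
      refine hlast.trans (congrArg (fun j => g'.vert (c j)) ?_)
      ext
      simp
    | cast i =>
      rw [hstep]
      congr 2
      ext
      simp only [Fin.val_castSucc, Fin.val_succ]
      rw [Nat.mod_eq_of_lt (by omega)]
  · rw [hdinv]
    exact hc.2.2 _ _

/-- Indecomposability persists when the first dart of a cycle is dropped and the graph changes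
by moving a cycle dart `s` and moving a dart `e` off the new cycle, provided the dropped edge
has an end `y` off the new cycle. -/
lemma indecomposable_succ {g g' : CubicGraph n} {m : ℕ} {c : Fin (m + 2) → Fin (6 * n)}
    (hind : g.Indecomposable (m + 2) c) (hdinv : ∀ d, g'.dinv d = g.dinv d)
    {e s y : Fin (6 * n)} (hy : y = c 0 ∨ y = g.dinv (c 0))
    (hs : ∃ i : Fin (m + 1), s = c i.succ ∨ s = g.dinv (c i.succ))
    (hsame : ∀ d, d ≠ e → d ≠ s → g'.vert d = g.vert d)
    (hout_e : ∀ i : Fin (m + 1), g'.vert e ≠ g'.vert (c i.succ))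
    (hout_y : ∀ i : Fin (m + 1), g'.vert y ≠ g'.vert (c i.succ))
    (hold : ∀ i : Fin (m + 1), ∃ j, g'.vert (c i.succ) = g.vert (c j)) :
    g'.Indecomposable (m + 1) fun i => c i.succ := by
  rintro d ⟨i, hi⟩ ⟨j, hj⟩
  simp only [hdinv] at hj ⊢
  have hde : d ≠ e := fun h => hout_e i (h ▸ hi)
  have hde' : g.dinv d ≠ e := fun h => hout_e j (h ▸ hj)
  have hdy : d ≠ y := fun h => hout_y i (h ▸ hi)
  have hdy' : g.dinv d ≠ y := fun h => hout_y j (h ▸ hj)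
  obtain ⟨l, hl⟩ := hs
  by_cases hds : d = s
  · exact ⟨l, hds ▸ hl⟩
  by_cases hds' : g.dinv d = s
  · refine ⟨l, ?_⟩
    rw [← hds'] at hl
    rcases hl with hl | hl
    · exact Or.inr (by rw [← hl, g.dinv_invol])
    · exact Or.inl (g.dinv_injective hl)
  rw [hsame d hde hds] at hi
  rw [hsame _ hde' hds'] at hj
  obtain ⟨i', hi'⟩ := hold i
  obtain ⟨j', hj'⟩ := hold j
  obtain ⟨p, hp⟩ := hind d ⟨i', hi.trans hi'⟩ ⟨j', hj.trans hj'⟩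
  induction p using Fin.cases with
  | zero =>
    exfalso
    rcases hp with rfl | rfl <;> rcases hy with rfl | rfl <;>
      simp_all [g.dinv_invol]
  | succ p => exact ⟨p, hp⟩

/-- Attaching the last dart of the cycle to the second vertex, in exchange for the dart `e`
pointing out of the cycle there, shortens the cycle. -/
lemma swapDarts_last_shortens {g : CubicGraph n} {m : ℕ} {c : Fin (m + 2) → Fin (6 * n)}
    (hc : g.IsCycle (m + 2) c) (hind : g.Indecomposable (m + 2) c) {e : Fin (6 * n)}
    (he : g.vert e = g.vert (c 1)) (he0 : e ≠ g.dinv (c 0)) (he1 : e ≠ c 1) :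
    (g.swapDarts (g.dinv (c (Fin.last _))) e).IsCycle (m + 1) (fun i => c i.succ) ∧
    (g.swapDarts (g.dinv (c (Fin.last _))) e).Indecomposable (m + 1) (fun i => c i.succ) ∧
    ∀ i : Fin (m + 1), ∃ j,
      (g.swapDarts (g.dinv (c (Fin.last _))) e).vert (c i.succ) = g.vert (c j) := by
  set s := g.dinv (c (Fin.last _)) with hs
  have hce : ∀ i, c i ≠ e := by
    rintro i rfl
    exact he1 (by rw [hc.index_eq he])
  have hcs : ∀ i, c i ≠ s := fun i => hc.2.2 _ _
  have hvert : ∀ i, (g.swapDarts s e).vert (c i) = g.vert (c i) := fun i =>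
    g.swapDarts_vert_of_ne (hcs i) (hce i)
  have hve : (g.swapDarts s e).vert e = g.vert (c 0) := by
    rw [swapDarts_vert_right, hs, hc.vert_dinv_last]
  have hne : ∀ i : Fin (m + 1), g.vert (c 0) ≠ g.vert (c i.succ) := fun i h =>
    (Fin.succ_ne_zero i) (hc.index_eq h).symm
  have hold : ∀ i : Fin (m + 1), ∃ j, (g.swapDarts s e).vert (c i.succ) = g.vert (c j) :=
    fun i => ⟨_, hvert _⟩
  refine ⟨isCycle_succ hc (fun _ => rfl) (fun i => ?_) ?_ (fun i j h => ?_),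
    indecomposable_succ (e := e) (s := s) (y := c 0) hind (fun _ => rfl) (Or.inl rfl)
      ⟨Fin.last _, Or.inr hs⟩ (fun d h h' => g.swapDarts_vert_of_ne h' h) (fun i => ?_)
      (fun i => ?_) hold, hold⟩
  · rw [hvert, Fin.succ_castSucc, g.swapDarts_vert_of_ne, hc.vert_dinv_castSucc]
    · intro h
      have := hc.index_eq (congrArg g.vert (g.dinv_injective h))
      exact (Fin.castSucc_lt_last _).ne this
    · rintro rfl
      rw [hc.vert_dinv_castSucc] at he
      have := hc.index_eq he
      simp [Fin.ext_iff] at this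
  · rw [hvert, ← hs, swapDarts_vert_left, he]
  · simp only [hvert] at h
    exact Fin.succ_injective _ (hc.index_eq h)
  · rw [hve, hvert]
    exact hne i
  · rw [hvert, hvert]
    exact hne i

/-- Attaching the second dart of the cycle to the first vertex, in exchange for the dart `e`
pointing out of the cycle there, shortens the cycle. -/
lemma swapDarts_one_shortens {g : CubicGraph n} {m : ℕ} {c : Fin (m + 2) → Fin (6 * n)}
    (hc : g.IsCycle (m + 2) c) (hind : g.Indecomposable (m + 2) c) {e : Fin (6 * n)}
    (he : g.vert e = g.vert (c 0)) (he0 : e ≠ c 0) (he1 : e ≠ g.dinv (c (Fin.last _))) :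
    (g.swapDarts e (c 1)).IsCycle (m + 1) (fun i => c i.succ) ∧
    (g.swapDarts e (c 1)).Indecomposable (m + 1) (fun i => c i.succ) ∧
    ∀ i : Fin (m + 1), ∃ j, (g.swapDarts e (c 1)).vert (c i.succ) = g.vert (c j) := by
  have hce : ∀ i, c i ≠ e := by
    rintro i rfl
    exact he0 (by rw [hc.index_eq he])
  have hinvc : ∀ i j, g.dinv (c i) ≠ c j := fun i j => (hc.2.2 i j).symm
  have hinve : ∀ i, g.dinv (c i) ≠ e := by
    rintro i rfl
    induction i using Fin.lastCases with
    | last => exact he1 rfl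
    | cast i =>
      rw [hc.vert_dinv_castSucc] at he
      exact Fin.succ_ne_zero i (hc.index_eq he)
  have hinv : ∀ i, (g.swapDarts e (c 1)).vert (g.dinv (c i)) = g.vert (g.dinv (c i)) := fun i =>
    g.swapDarts_vert_of_ne (hinve i) (hinvc i 1)
  have hone : (g.swapDarts e (c 1)).vert (c 1) = g.vert (c 0) := by
    rw [swapDarts_vert_right, he]
  have hvert : ∀ i, i ≠ 1 → (g.swapDarts e (c 1)).vert (c i) = g.vert (c i) := fun i hi =>
    g.swapDarts_vert_of_ne (hce i) fun h => hi (hc.index_eq (congrArg g.vert h))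
  have hsucc : ∀ i : Fin m, i.succ.succ ≠ 1 := fun i h => by simp [Fin.ext_iff] at h
  have hne : ∀ i : Fin (m + 1), g.vert (c 1) ≠ (g.swapDarts e (c 1)).vert (c i.succ) := by
    intro i h
    induction i using Fin.cases with
    | zero =>
      rw [Fin.succ_zero_eq_one, hone] at h
      exact one_ne_zero (hc.index_eq h)
    | succ i =>
      rw [hvert _ (hsucc i)] at h
      exact hsucc i (hc.index_eq h).symm
  have hold : ∀ i : Fin (m + 1), ∃ j, (g.swapDarts e (c 1)).vert (c i.succ) = g.vert (c j) := by
    intro i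
    induction i using Fin.cases with
    | zero => exact ⟨0, hone⟩
    | succ i => exact ⟨_, hvert _ (hsucc i)⟩
  refine ⟨isCycle_succ hc (fun _ => rfl) (fun i => ?_) ?_ (fun i j h => ?_),
    indecomposable_succ (e := e) (s := c 1) (y := g.dinv (c 0)) hind (fun _ => rfl)
      (Or.inr rfl) ⟨0, Or.inl rfl⟩ (fun d h h' => g.swapDarts_vert_of_ne h h') (fun i => ?_)
      (fun i => ?_) hold, hold⟩
  · rw [hinv, hvert _ (hsucc i), Fin.succ_castSucc, hc.vert_dinv_castSucc]
  · rw [hinv, hone, hc.vert_dinv_last]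
  · induction i using Fin.cases with
    | zero =>
      induction j using Fin.cases with
      | zero => rfl
      | succ j =>
        simp only [Fin.succ_zero_eq_one, hone, hvert _ (hsucc j)] at h
        exact absurd (hc.index_eq h).symm (Fin.succ_ne_zero _)
    | succ i =>
      induction j using Fin.cases with
      | zero =>
        simp only [Fin.succ_zero_eq_one, hone, hvert _ (hsucc i)] at h
        exact absurd (hc.index_eq h) (Fin.succ_ne_zero _)
      | succ j =>
        simp only [hvert _ (hsucc i), hvert _ (hsucc j)] at h
        exact Fin.succ_injective _ (hc.index_eq h)
  · rw [swapDarts_vert_left]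
    exact hne i
  · rw [hinv, hc.vert_dinv_zero]
    exact hne i

/-- One of the two Whitehead moves on the first edge of an indecomposable cycle shortens it,
without using new vertices. -/
lemma exists_wh_shortens {g : CubicGraph n} {m : ℕ} {c : Fin (m + 2) → Fin (6 * n)}
    (hc : g.IsCycle (m + 2) c) (hind : g.Indecomposable (m + 2) c) :
    ∃ i, (g.wh i (c 0)).IsCycle (m + 1) (fun i => c i.succ) ∧
      (g.wh i (c 0)).Indecomposable (m + 1) (fun i => c i.succ) ∧
      ∀ l : Fin (m + 1), ∃ j, (g.wh i (c 0)).vert (c l.succ) = g.vert (c j) := by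
  have hloop : ¬ g.IsLoop (c 0) := fun h =>
    one_ne_zero (hc.index_eq (hc.vert_dinv_zero.symm.trans h))
  by_cases hmax : g.oMax (c 0) = g.dinv (c (Fin.last _))
  · obtain ⟨e, he, hne⟩ := Finset.exists_mem_ne
      (by rw [card_othersAt]; norm_num : 1 < (g.othersAt (g.dinv (c 0))).card) (c 1)
    obtain ⟨i, hi⟩ := exists_wh_eq_swapDarts hloop he
    rw [mem_othersAt, hc.vert_dinv_zero] at he
    refine ⟨i, ?_⟩
    rw [hi, hmax]
    exact swapDarts_last_shortens hc hind he.2 he.1 hne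
  · obtain ⟨i, hi⟩ := exists_wh_eq_swapDarts hloop
      (mem_othersAt.2 ⟨hc.2.2 0 1, hc.vert_dinv_zero.symm⟩)
    have hmem := mem_othersAt.1 (g.oMax_mem (c 0))
    refine ⟨i, ?_⟩
    rw [hi]
    exact swapDarts_one_shortens hc hind hmem.2 hmem.1 hmax

/-- An indecomposable cycle of length `m + 1` is reduced by `m` Whitehead moves to a loop based
at one of its vertices. -/
lemma exists_wh_sequence_loop (m : ℕ) (g : CubicGraph n) (c : Fin (m + 1) → Fin (6 * n))
    (hc : g.IsCycle (m + 1) c) (hind : g.Indecomposable (m + 1) c) :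
    ∃ gs : ℕ → CubicGraph n, gs 0 = g ∧
      (∀ l, l < m → ∃ (i : Fin 2) (x : Fin (6 * n)), gs (l + 1) = (gs l).wh i x) ∧
      ∃ d, (gs m).IsLoop d ∧ ∃ j, (gs m).vert d = g.vert (c j) := by
  induction m generalizing g with
  | zero => exact ⟨fun _ => g, rfl, by simp, c 0, hc.1 0, 0, rfl⟩
  | succ m ih =>
    obtain ⟨i, hc', hind', hold⟩ := exists_wh_shortens hc hind
    obtain ⟨gs, hgs, hstep, d, hd, j, hj⟩ := ih _ _ hc' hind'
    obtain ⟨j', hj'⟩ := hold j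
    refine ⟨fun l => Nat.casesOn l g gs, rfl, fun l hl => ?_, d, hd, j', hj.trans hj'⟩
    cases l with
    | zero => exact ⟨i, c 0, hgs⟩
    | succ l => exact hstep l (by omega)

end CubicGraph

/-- A Whitehead move on an edge of an indecomposable `k`-cycle (`k ≥ 2`)
turns it into an indecomposable `(k-1)`-cycle; consequently `k - 1` Whitehead moves reduce
the cycle to a loop (based at one of the original cycle's vertices). -/
theorem cycle_shortening (n k : ℕ) (hk : 2 ≤ k) (g : CubicGraph n) (hg : g.Connected)
    (c : Fin k → Fin (6 * n)) (hc : g.IsCycle k c) (hind : g.Indecomposable k c) :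
    (∃ (i : Fin 2) (x : Fin (6 * n)),
      (∃ j, x = c j ∨ x = g.dinv (c j)) ∧
      ∃ c' : Fin (k - 1) → Fin (6 * n),
        (g.wh i x).IsCycle (k - 1) c' ∧ (g.wh i x).Indecomposable (k - 1) c') ∧
    ∃ gs : ℕ → CubicGraph n, gs 0 = g ∧
      (∀ m, m < k - 1 → ∃ (i : Fin 2) (x : Fin (6 * n)), gs (m + 1) = (gs m).wh i x) ∧
      ∃ d, (gs (k - 1)).IsLoop d ∧ ∃ j, (gs (k - 1)).vert d = g.vert (c j) := by
  obtain ⟨m, rfl⟩ := Nat.exists_eq_add_of_le' hk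
  obtain ⟨i, hc', hind', -⟩ := CubicGraph.exists_wh_shortens hc hind
  exact ⟨⟨i, c 0, ⟨0, Or.inl rfl⟩, _, hc', hind'⟩,
    CubicGraph.exists_wh_sequence_loop (m + 1) g c hc hind⟩
end

section
/- For n ≥ 1 there is a bijection between rooted (n, n+1)-cubic trees with a chosen loop ε* as root, and rooted binary trees on 2n−1 vertices with n leaves; the bijection is given by deleting from the cubic tree all loops together with the edge adjacent to the chosen loop ε*, rooting the resulting tree at the vertex that was adjacent across that deleted edge. -/
/-- A rooted tree on the vertex set `Fin m`, given by its parent function. -/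
structure ParentTree (m : ℕ) where
  par : Fin m → Fin m
  root : Fin m
  par_root : par root = root
  reaches : ∀ v, ∃ k, par^[k] v = root

namespace ParentTree

variable {m : ℕ}

/-- The number of children of a vertex. -/
def childCount (t : ParentTree m) (v : Fin m) : ℕ :=
  (Finset.univ.filter fun u => t.par u = v ∧ u ≠ v).card

/-- A rooted binary tree: every non-leaf vertex has exactly two children. -/
def IsBinary (t : ParentTree m) : Prop := ∀ v, t.childCount v = 0 ∨ t.childCount v = 2

/-- The number of leaves. -/
def leafCount (t : ParentTree m) : ℕ :=
  (Finset.univ.filter fun v => t.childCount v = 0).card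

/-- Isomorphism of rooted trees. -/
def Isom (t₁ t₂ : ParentTree m) : Prop :=
  ∃ σ : Fin m ≃ Fin m, σ t₁.root = t₂.root ∧ ∀ v, σ (t₁.par v) = t₂.par (σ v)

/-- `t'` is obtained from `t` by a (left or right) tree rotation: for an edge `u — v` with
`v = t.par u` and a child `b` of `u`, the vertex `u` replaces `v` (taking over its parent,
or becoming the root if `v` was the root), `v` becomes a child of `u`, and the subtree rooted
at `b` is re-attached below `v`. -/
def IsRotation (t t' : ParentTree m) : Prop :=
  ∃ u v b : Fin m, u ≠ v ∧ b ≠ u ∧ b ≠ v ∧ t.par u = v ∧ t.par b = u ∧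
    t'.root = (if v = t.root then u else t.root) ∧
    t'.par = fun w =>
      if w = u then (if v = t.root then u else t.par v)
      else if w = v then u
      else if w = b then v
      else t.par w

end ParentTree

/-- `t` is the rooted binary tree obtained from the rooted cubic tree `(g, ε)` (`ε` a chosen
loop of `g`) by deleting all loops together with the edge joining the vertex of `ε` to the
rest of the graph: `φ` identifies the vertices of `t` with the vertices of `g` other than
the vertex carrying `ε`; the root corresponds to the vertex adjacent to the vertex of `ε`;
and adjacency in `t` corresponds exactly to non-loop adjacency in `g`. -/
def DeletionCorresponds (n : ℕ) (g : CubicGraph n) (ε : Fin (6 * n))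
    (t : ParentTree (2 * n - 1)) : Prop :=
  ∃ φ : Fin (2 * n - 1) → Fin (2 * n), Function.Injective φ ∧
    Set.range φ = {v | v ≠ g.vert ε} ∧
    (∃ d, ¬ g.IsLoop d ∧ g.vert d = g.vert ε ∧ g.vert (g.dinv d) = φ t.root) ∧
    ∀ u w : Fin (2 * n - 1), u ≠ w →
      ((t.par u = w ∨ t.par w = u) ↔
        ∃ d, ¬ g.IsLoop d ∧ g.vert d = φ u ∧ g.vert (g.dinv d) = φ w)

/-- A rooted `(n, n+1)`-cubic tree: a connected cubic graph on `2n` vertices all of whose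
cycles are loops, together with a chosen loop (given by one of its darts). -/
def RootedCubicTree (n : ℕ) :=
  {p : CubicGraph n × Fin (6 * n) //
    p.1.Connected ∧ p.1.OnlyLoopCycles ∧ p.1.IsLoop p.2}

/-- Isomorphism of rooted cubic trees (carrying the chosen loop to the chosen loop). -/
def rctIso {n : ℕ} (a b : RootedCubicTree n) : Prop :=
  ∃ I : CubicGraph.Iso a.1.1 b.1.1,
    I.dartEquiv a.1.2 = b.1.2 ∨ I.dartEquiv a.1.2 = b.1.1.dinv b.1.2

/-- Rooted binary trees on `2n - 1` vertices with `n` leaves. -/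
def BinRootedTree (n : ℕ) :=
  {t : ParentTree (2 * n - 1) // t.IsBinary ∧ t.leafCount = n}

def brtIso {n : ℕ} (a b : BinRootedTree n) : Prop := a.1.Isom b.1

/-- Ordered full binary trees. -/
inductive BTree where
  | leaf : BTree
  | node : BTree → BTree → BTree

namespace BTree

/-- The number of leaves of a binary tree. -/
def leaves : BTree → ℕ
  | leaf => 1
  | node l r => l.leaves + r.leaves

/-- A single left or right tree rotation, performed at the root or deeper inside the tree. -/
inductive Rot : BTree → BTree → Prop
  | rotR (A B C : BTree) : Rot (node (node A B) C) (node A (node B C))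
  | rotL (A B C : BTree) : Rot (node A (node B C)) (node (node A B) C)
  | congL {l l' : BTree} (r : BTree) : Rot l l' → Rot (node l r) (node l' r)
  | congR (l : BTree) {r r' : BTree} : Rot r r' → Rot (node l r) (node l r')

end BTree

/-- The complete rooted binary tree with `m` leaves (levels full except possibly the last,
which is filled from the left). -/
def completeBTree : ℕ → BTree
  | 0 => .leaf
  | 1 => .leaf
  | (m + 2) => .node (completeBTree ((m + 3) / 2)) (completeBTree ((m + 2) / 2))
  termination_by m => m
  decreasing_by all_goals omega

namespace SimpleGraph

/-- A tree with a marked vertex `r` has a parent function pointing towards `r`. -/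
theorem IsTree.exists_parent_function {V : Type*} {G : SimpleGraph V} (hG : G.IsTree) (r : V) :
    ∃ (P : V → V) (h : V → ℕ), (∀ v, v ≠ r → G.Adj v (P v) ∧ h (P v) < h v) ∧
      ∀ v w, G.Adj v w → (v ≠ r ∧ P v = w) ∨ (w ≠ r ∧ P w = v) := by
  choose f hf huniq using fun v => hG.existsUnique_path r v
  refine ⟨fun v => (f v).penultimate, fun v => (f v).length, ?_, ?_⟩
  · intro v hv
    have hnil : ¬ (f v).Nil := Walk.not_nil_of_ne hv.symm
    refine ⟨(Walk.adj_penultimate hnil).symm, ?_⟩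
    have h1 : (f v).dropLast = f (f v).penultimate := huniq _ _ (hf v).dropLast
    have h2 := Walk.length_dropLast_add_one hnil
    rw [h1] at h2
    simp only
    omega
  · have key : ∀ v w (hvw : G.Adj v w), v ∈ (f w).support → w ≠ r ∧ (f w).penultimate = v := by
      intro v w hvw hv
      have h := hG.isAcyclic.path_concat (hf v) (hf w) hvw hv
      refine ⟨?_, by rw [h]; simp⟩
      rintro rfl
      have h' := huniq w Walk.nil (by simp)
      rw [← h'] at hv
      simp at hv
      exact hvw.ne hv
    intro v w hvw
    by_cases hv : v ∈ (f w).support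
    · exact .inr (key v w hvw hv)
    · exact .inl (key w v hvw.symm
        (hG.isAcyclic.mem_support_of_ne_mem_support_of_adj_of_isPath (hf v) (hf w) hvw hv))

end SimpleGraph

namespace ParentTree

variable {m : ℕ}

/-- The distance from a vertex to the root. -/
def depth (t : ParentTree m) (v : Fin m) : ℕ := Nat.find (t.reaches v)

theorem depth_par_lt (t : ParentTree m) {v : Fin m} (hv : v ≠ t.root) :
    t.depth (t.par v) < t.depth v := by
  have h := Nat.find_spec (t.reaches v)
  unfold depth
  rcases hk : Nat.find (t.reaches v) with _ | k
  · rw [hk] at h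
    exact absurd h hv
  · rw [hk, Function.iterate_succ_apply] at h
    exact Nat.lt_succ_of_le (Nat.find_min' _ h)

theorem par_ne (t : ParentTree m) {v : Fin m} (hv : v ≠ t.root) : t.par v ≠ v := fun h => by
  have := t.depth_par_lt hv
  rw [h] at this
  exact lt_irrefl _ this

theorem par_eq_self_iff (t : ParentTree m) {v : Fin m} : t.par v = v ↔ v = t.root :=
  ⟨fun h => by_contra fun hv => t.par_ne hv h, fun h => h ▸ t.par_root⟩

theorem par_par_ne (t : ParentTree m) {v : Fin m} (hv : v ≠ t.root) : t.par (t.par v) ≠ v := by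
  intro h
  by_cases hp : t.par v = t.root
  · rw [hp, t.par_root] at h
    exact hv h.symm
  · have h1 := t.depth_par_lt hv
    have h2 := t.depth_par_lt hp
    rw [h] at h2
    omega

theorem induction_par (t : ParentTree m) {p : Fin m → Prop} (root : p t.root)
    (step : ∀ v, v ≠ t.root → p (t.par v) → p v) (v : Fin m) : p v := by
  induction h : t.depth v using Nat.strong_induction_on generalizing v with
  | _ k ih =>
    by_cases hv : v = t.root
    · exact hv ▸ root
    · exact step v hv (ih _ (h ▸ t.depth_par_lt hv) _ rfl)

theorem sum_childCount (t : ParentTree m) : ∑ v, t.childCount v = m - 1 := by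
  have h := Finset.card_eq_sum_card_fiberwise (f := t.par)
    (s := Finset.univ.filter fun u => u ≠ t.root) (t := Finset.univ) (by simp [Set.MapsTo])
  rw [Finset.filter_ne', Finset.card_erase_of_mem (Finset.mem_univ _), Finset.card_univ,
    Fintype.card_fin] at h
  rw [h]
  refine Finset.sum_congr rfl fun v _ => ?_
  unfold childCount
  congr 1
  ext u
  simp only [Finset.mem_filter, Finset.mem_univ, true_and, Finset.mem_erase, and_true]
  constructor
  · rintro ⟨rfl, h⟩
    exact ⟨fun hu => h (t.par_eq_self_iff.2 hu).symm, rfl⟩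
  · rintro ⟨h, rfl⟩
    exact ⟨rfl, fun hu => h (t.par_eq_self_iff.1 hu.symm)⟩

theorem IsBinary.two_mul_leafCount {t : ParentTree m} (ht : t.IsBinary) :
    2 * t.leafCount = m + 1 := by
  have h1 := t.sum_childCount
  have h2 := Finset.card_filter_add_card_filter_not (s := (Finset.univ : Finset (Fin m)))
    (fun v => t.childCount v = 0)
  have h3 : ∑ v, t.childCount v
      = 2 * (Finset.univ.filter fun v => ¬ t.childCount v = 0).card := by
    rw [Finset.card_filter, Finset.mul_sum]
    refine Finset.sum_congr rfl fun v _ => ?_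
    rcases ht v with h | h <;> simp [h]
  have hm : 0 < m := t.root.pos
  rw [Finset.card_univ, Fintype.card_fin] at h2
  unfold leafCount
  omega

theorem Isom.symm {t t' : ParentTree m} (h : t.Isom t') : t'.Isom t := by
  obtain ⟨σ, hσ, hpar⟩ := h
  refine ⟨σ.symm, by rw [← hσ, σ.symm_apply_apply], fun v => ?_⟩
  rw [Equiv.symm_apply_eq, hpar, σ.apply_symm_apply]

/-- A bijection preserving roots and adjacency also preserves parents. -/
theorem map_par_of_map_adj {t t' : ParentTree m} (σ : Fin m ≃ Fin m)
    (hroot : σ t.root = t'.root)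
    (hadj : ∀ u w, u ≠ w → (t.par u = w ∨ t.par w = u) →
      (t'.par (σ u) = σ w ∨ t'.par (σ w) = σ u)) (v : Fin m) :
    σ (t.par v) = t'.par (σ v) := by
  induction v using t.induction_par with
  | root => rw [t.par_root, hroot, t'.par_root]
  | step v hv ih =>
    rcases hadj v (t.par v) (t.par_ne hv).symm (.inl rfl) with h | h
    · exact h.symm
    · rw [← ih] at h
      exact absurd (σ.injective h) (t.par_par_ne hv)

end ParentTree

namespace CubicGraph

variable {n : ℕ}

/-- Two vertices are joined by an edge which is not a loop. -/
def NonloopAdj (g : CubicGraph n) (v w : Fin (2 * n)) : Prop :=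
  ∃ d, ¬ g.IsLoop d ∧ g.vert d = v ∧ g.vert (g.dinv d) = w

theorem isLoop_dinv (g : CubicGraph n) (d : Fin (6 * n)) : g.IsLoop (g.dinv d) ↔ g.IsLoop d := by
  unfold IsLoop
  rw [g.dinv_invol, eq_comm]

theorem NonloopAdj.symm {g : CubicGraph n} {v w : Fin (2 * n)} (h : g.NonloopAdj v w) :
    g.NonloopAdj w v := by
  obtain ⟨d, hd, rfl, rfl⟩ := h
  exact ⟨g.dinv d, by rwa [isLoop_dinv], rfl, by rw [g.dinv_invol]⟩

theorem NonloopAdj.ne {g : CubicGraph n} {v w : Fin (2 * n)} (h : g.NonloopAdj v w) : v ≠ w := by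
  obtain ⟨d, hd, rfl, rfl⟩ := h
  exact fun h => hd h.symm

/-- The simple graph obtained by deleting all loops and merging parallel edges. -/
def toSimple (g : CubicGraph n) : SimpleGraph (Fin (2 * n)) where
  Adj := g.NonloopAdj
  symm := ⟨fun _ _ h => h.symm⟩
  loopless := ⟨fun _ h => h.ne rfl⟩

theorem exists_vert_eq (g : CubicGraph n) (v : Fin (2 * n)) : ∃ d, g.vert d = v := by
  have h : 0 < (Finset.univ.filter fun d => g.vert d = v).card := by rw [g.regular]; norm_num
  obtain ⟨d, hd⟩ := Finset.card_pos.1 h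
  exact ⟨d, (Finset.mem_filter.1 hd).2⟩

theorem eq_or_eq_dinv_of_isLoop (g : CubicGraph n) {d d' : Fin (6 * n)} (hd : g.IsLoop d)
    (hd' : g.IsLoop d') (h : g.vert d' = g.vert d) : d' = d ∨ d' = g.dinv d := by
  by_contra! hne
  have hsub : ({d, g.dinv d, d', g.dinv d'} : Finset _)
      ⊆ Finset.univ.filter fun x => g.vert x = g.vert d := by
    intro x hx
    simp only [Finset.mem_insert, Finset.mem_singleton] at hx
    simp only [Finset.mem_filter, Finset.mem_univ, true_and]
    unfold IsLoop at hd hd'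
    rcases hx with rfl | rfl | rfl | rfl <;> simp [*]
  have hcard := Finset.card_le_card hsub
  have h1 := g.dinv_ne d
  have h2 := g.dinv_ne d'
  have h3 : d ≠ g.dinv d' := fun h => hne.2 (by rw [h, g.dinv_invol])
  have h4 : g.dinv d ≠ g.dinv d' := fun h => hne.1 (by rw [← g.dinv_invol d, h, g.dinv_invol])
  rw [g.regular, Finset.card_insert_of_notMem, Finset.card_insert_of_notMem,
    Finset.card_insert_of_notMem, Finset.card_singleton] at hcard
  · omega
  · simpa using h2.symm
  · simpa using ⟨hne.2.symm, h4⟩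
  · simpa using ⟨h1.symm, hne.1.symm, h3⟩

theorem OnlyLoopCycles.dart_unique {g : CubicGraph n} (hg : g.OnlyLoopCycles)
    {d d' : Fin (6 * n)} (hd : ¬ g.IsLoop d) (h : g.vert d = g.vert d')
    (h' : g.vert (g.dinv d) = g.vert (g.dinv d')) : d = d' := by
  by_contra hne
  refine hg 2 le_rfl ![d, g.dinv d'] ⟨?_, ?_, ?_⟩
  · intro i
    fin_cases i
    · simpa using h'
    · simpa [g.dinv_invol] using h.symm
  · intro i j hij
    unfold IsLoop at hd
    fin_cases i <;> fin_cases j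
    · rfl
    · exact absurd hij (by simpa [← h'] using fun h => hd h.symm)
    · exact absurd hij (by simpa [← h'] using hd)
    · rfl
  · intro i j
    have h3 : g.dinv d' ≠ g.dinv d := fun h => hne (by rw [← g.dinv_invol d, ← h, g.dinv_invol])
    fin_cases i <;> fin_cases j
    · simpa using (g.dinv_ne d).symm
    · simpa using h3
    · simpa [g.dinv_invol] using hne
    · simpa using (g.dinv_ne _).symm

open Classical in
/-- The neighbours of a vertex, other than itself. -/
noncomputable def nbrs (g : CubicGraph n) (v : Fin (2 * n)) : Finset (Fin (2 * n)) :=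
  Finset.univ.filter fun w => g.NonloopAdj v w

theorem mem_nbrs {g : CubicGraph n} {v w : Fin (2 * n)} : w ∈ g.nbrs v ↔ g.NonloopAdj v w := by
  simp [nbrs]

theorem OnlyLoopCycles.card_nbrs {g : CubicGraph n} (hg : g.OnlyLoopCycles) (v : Fin (2 * n)) :
    (g.nbrs v).card = (Finset.univ.filter fun d => g.vert d = v ∧ ¬ g.IsLoop d).card := by
  classical
  symm
  refine Finset.card_bij (fun d _ => g.vert (g.dinv d)) ?_ ?_ ?_
  · intro d hd
    simp only [Finset.mem_filter, Finset.mem_univ, true_and] at hd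
    exact mem_nbrs.2 ⟨d, hd.2, hd.1, rfl⟩
  · intro d hd d' hd' h
    simp only [Finset.mem_filter, Finset.mem_univ, true_and] at hd hd'
    exact hg.dart_unique hd.2 (hd.1.trans hd'.1.symm) h
  · intro w hw
    obtain ⟨d, hd, hv, rfl⟩ := mem_nbrs.1 hw
    exact ⟨d, by simp [hd, hv], rfl⟩

theorem OnlyLoopCycles.card_nbrs_of_isLoop {g : CubicGraph n} (hg : g.OnlyLoopCycles)
    {d : Fin (6 * n)} (hd : g.IsLoop d) : (g.nbrs (g.vert d)).card = 1 := by
  have h : (Finset.univ.filter fun x => g.vert x = g.vert d ∧ ¬ g.IsLoop x)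
      = ((Finset.univ.filter fun x => g.vert x = g.vert d).erase d).erase (g.dinv d) := by
    ext x
    simp only [Finset.mem_filter, Finset.mem_univ, true_and, Finset.mem_erase]
    constructor
    · rintro ⟨h1, h2⟩
      refine ⟨?_, ?_, h1⟩
      · rintro rfl
        exact h2 ((g.isLoop_dinv d).2 hd)
      · rintro rfl
        exact h2 hd
    · rintro ⟨h1, h2, h3⟩
      refine ⟨h3, fun hx => ?_⟩
      rcases g.eq_or_eq_dinv_of_isLoop hd hx h3 with h | h
      exacts [h2 h, h1 h]
  rw [hg.card_nbrs, h, Finset.card_erase_of_mem, Finset.card_erase_of_mem, g.regular]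
  · simp
  · have hd' : g.vert (g.dinv d) = g.vert d := hd
    simpa [g.dinv_ne] using hd'

theorem OnlyLoopCycles.card_nbrs_of_forall {g : CubicGraph n} (hg : g.OnlyLoopCycles)
    {v : Fin (2 * n)} (hv : ∀ d, g.vert d = v → ¬ g.IsLoop d) : (g.nbrs v).card = 3 := by
  rw [hg.card_nbrs, ← g.regular v]
  congr 1
  ext d
  simpa using hv d

theorem OnlyLoopCycles.card_nbrs_eq_one_or_three {g : CubicGraph n} (hg : g.OnlyLoopCycles)
    (v : Fin (2 * n)) : (g.nbrs v).card = 1 ∨ (g.nbrs v).card = 3 := by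
  by_cases h : ∀ d, g.vert d = v → ¬ g.IsLoop d
  · exact .inr (hg.card_nbrs_of_forall h)
  · push Not at h
    obtain ⟨d, rfl, hd⟩ := h
    exact .inl (hg.card_nbrs_of_isLoop hd)

/-- The vertex of a loop has exactly one neighbour. -/
theorem OnlyLoopCycles.existsUnique_nonloopAdj {g : CubicGraph n} (hg : g.OnlyLoopCycles)
    {d : Fin (6 * n)} (hd : g.IsLoop d) :
    ∃ r, ∀ w, g.NonloopAdj (g.vert d) w ↔ w = r := by
  obtain ⟨r, hr⟩ := Finset.card_eq_one.1 (hg.card_nbrs_of_isLoop hd)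
  exact ⟨r, fun w => by rw [← mem_nbrs, hr, Finset.mem_singleton]⟩

theorem OnlyLoopCycles.isAcyclic_toSimple {g : CubicGraph n} (hg : g.OnlyLoopCycles) :
    g.toSimple.IsAcyclic := by
  intro v p hp
  have h3 := hp.three_le_length
  have hadj : ∀ i : Fin p.length, g.NonloopAdj (p.getVert i) (p.getVert (i + 1)) :=
    fun i => p.adj_getVert_succ i.2
  choose c hc hc1 hc2 using hadj
  have hinj : ∀ i j, i < p.length → j < p.length → p.getVert i = p.getVert j → i = j := by
    intro i j hi hj h
    exact hp.getVert_injOn' (by simp; omega) (by simp; omega) h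
  have hmod : ∀ i, i < p.length → p.getVert (i + 1) = p.getVert ((i + 1) % p.length) := by
    intro i hi
    rcases Nat.lt_or_ge (i + 1) p.length with h | h
    · rw [Nat.mod_eq_of_lt h]
    · have h : i + 1 = p.length := by omega
      rw [h, Nat.mod_self, p.getVert_length, p.getVert_zero]
  refine hg p.length (by omega) c ⟨?_, ?_, ?_⟩
  · intro i
    rw [hc2, hc1]
    exact hmod i i.2
  · intro i j hij
    simp only [hc1] at hij
    exact Fin.ext (hinj _ _ i.2 j.2 hij)
  · intro i j h
    have h1 : p.getVert j = p.getVert ((i + 1) % p.length) := by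
      rw [← hmod i i.2, ← hc1, ← hc2, h]
    have h2 : p.getVert i = p.getVert ((j + 1) % p.length) := by
      rw [← hmod j j.2, ← hc1, ← hc2, h, g.dinv_invol]
    have h1 := hinj _ _ j.2 (Nat.mod_lt _ (by omega)) h1
    have h2 := hinj _ _ i.2 (Nat.mod_lt _ (by omega)) h2
    have hi := i.2
    have hj := j.2
    rcases Nat.lt_or_ge (i + 1) p.length with h | h
    · rw [Nat.mod_eq_of_lt h] at h1
      rcases Nat.lt_or_ge (j + 1) p.length with h' | h'
      · rw [Nat.mod_eq_of_lt h'] at h2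
        omega
      · have h' : (j : ℕ) + 1 = p.length := by omega
        rw [h', Nat.mod_self] at h2
        omega
    · have h : (i : ℕ) + 1 = p.length := by omega
      rw [h, Nat.mod_self] at h1
      rw [h1, Nat.mod_eq_of_lt (by omega)] at h2
      omega

theorem Connected.isTree_toSimple {g : CubicGraph n} (hc : g.Connected) (hg : g.OnlyLoopCycles)
    [Nonempty (Fin (2 * n))] : g.toSimple.IsTree := by
  refine ⟨⟨fun v w => ?_⟩, hg.isAcyclic_toSimple⟩
  obtain ⟨d, rfl⟩ := g.exists_vert_eq v
  obtain ⟨d', rfl⟩ := g.exists_vert_eq w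
  have h := hc d d'
  unfold Reach at h
  induction h with
  | refl => exact SimpleGraph.Reachable.refl _
  | @tail a b _ hab ih =>
    refine ih.trans ?_
    rcases hab with hab | rfl
    · rw [hab]
    · by_cases hl : g.IsLoop a
      · rw [show g.vert (g.dinv a) = g.vert a from hl]
      · exact SimpleGraph.Adj.reachable (show g.NonloopAdj _ _ from ⟨a, hl, rfl, rfl⟩)

/-- A bijection of vertices preserving non-loop adjacency extends to an isomorphism. -/
theorem OnlyLoopCycles.exists_iso {g g' : CubicGraph n} (hg : g.OnlyLoopCycles)
    (hg' : g'.OnlyLoopCycles) (τ : Fin (2 * n) ≃ Fin (2 * n))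
    (hτ : ∀ v w, g.NonloopAdj v w ↔ g'.NonloopAdj (τ v) (τ w)) :
    ∃ I : Iso g g', I.vertEquiv = τ := by
  have hcard : ∀ v, (g'.nbrs (τ v)).card = (g.nbrs v).card := by
    intro v
    rw [← Finset.card_map τ.toEmbedding (s := g.nbrs v)]
    congr 1
    ext w
    rw [Finset.mem_map_equiv, mem_nbrs, mem_nbrs, hτ v (τ.symm w), τ.apply_symm_apply]
  have hkey : ∀ (g : CubicGraph n), g.OnlyLoopCycles → ∀ d d', g.vert d = g.vert d' →
      g.vert (g.dinv d) = g.vert (g.dinv d') →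
      (g.IsLoop d → (d < g.dinv d ↔ d' < g.dinv d')) → d = d' := by
    intro g hg d d' h1 h2 h3
    by_cases hd : g.IsLoop d
    · have hd' : g.IsLoop d' := by
        unfold IsLoop at hd ⊢
        rw [← h1, ← h2, hd]
      rcases g.eq_or_eq_dinv_of_isLoop hd hd' h1.symm with rfl | rfl
      · rfl
      · have h3 := h3 hd
        rw [g.dinv_invol] at h3
        have := g.dinv_ne d
        omega
    · exact hg.dart_unique hd h1 h2
  have hex : ∀ d, ∃ d', g'.vert d' = τ (g.vert d) ∧ g'.vert (g'.dinv d') = τ (g.vert (g.dinv d)) ∧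
      (g.IsLoop d → (d < g.dinv d ↔ d' < g'.dinv d')) := by
    intro d
    by_cases hd : g.IsLoop d
    · have hl : ∃ d', g'.vert d' = τ (g.vert d) ∧ g'.IsLoop d' := by
        by_contra! hl
        have h1 := hg'.card_nbrs_of_forall hl
        rw [hcard, hg.card_nbrs_of_isLoop hd] at h1
        omega
      obtain ⟨d', hv, hd'⟩ := hl
      have hd2 : g'.vert (g'.dinv d') = g'.vert d' := hd'
      have hd3 : g.vert (g.dinv d) = g.vert d := hd
      have hne := g'.dinv_ne d'
      by_cases h : d < g.dinv d ↔ d' < g'.dinv d'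
      · exact ⟨d', hv, by rw [hd2, hd3, hv], fun _ => h⟩
      · refine ⟨g'.dinv d', by rw [hd2, hv], by rw [g'.dinv_invol, hd3, hv], fun _ => ?_⟩
        rw [g'.dinv_invol]
        omega
    · obtain ⟨d', hd', h1, h2⟩ := (hτ _ _).1 ⟨d, hd, rfl, rfl⟩
      exact ⟨d', h1, h2, fun h => absurd h hd⟩
  choose f hf1 hf2 hf3 using hex
  have hloop : ∀ d, g'.IsLoop (f d) → g.IsLoop d := by
    intro d hd
    unfold IsLoop at hd ⊢
    rw [hf1, hf2] at hd
    exact τ.injective hd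
  have hinj : Function.Injective f := by
    intro d e h
    have h1 : g.vert d = g.vert e := τ.injective (by rw [← hf1, ← hf1, h])
    have h2 : g.vert (g.dinv d) = g.vert (g.dinv e) := τ.injective (by rw [← hf2, ← hf2, h])
    refine hkey g hg d e h1 h2 fun hd => ?_
    have he : g.IsLoop e := by
      unfold IsLoop at hd ⊢
      rw [← h1, ← h2, hd]
    rw [hf3 d hd, hf3 e he, h]
  refine ⟨⟨Equiv.ofBijective f (Finite.injective_iff_bijective.1 hinj), τ, fun d => ?_, hf1⟩, rfl⟩
  refine hkey g' hg' _ _ ((hf2 d).trans (hf1 _).symm) ?_ fun hd => ?_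
  · simp only [Equiv.ofBijective_apply]
    rw [g'.dinv_invol, hf1, hf2, g.dinv_invol]
  · simp only [Equiv.ofBijective_apply] at hd ⊢
    rw [isLoop_dinv] at hd
    have hd := hloop _ hd
    have h1 := hf3 d hd
    rw [← hf3 (g.dinv d) ((g.isLoop_dinv d).2 hd), g'.dinv_invol, g.dinv_invol]
    have h2 := g.dinv_ne d
    have h3 := g'.dinv_ne (f d)
    omega

end CubicGraph

namespace DeletionCorresponds

variable {n : ℕ}

theorem isom {g : CubicGraph n} {ε : Fin (6 * n)} (hg : g.OnlyLoopCycles) (hε : g.IsLoop ε)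
    {t t' : ParentTree (2 * n - 1)} (h : DeletionCorresponds n g ε t)
    (h' : DeletionCorresponds n g ε t') : t.Isom t' := by
  obtain ⟨φ, hφ, hran, hroot, hadj⟩ := h
  obtain ⟨φ', hφ', hran', hroot', hadj'⟩ := h'
  obtain ⟨r, hr⟩ := hg.existsUnique_nonloopAdj hε
  let σ := (Equiv.ofInjective φ hφ).trans
    ((Equiv.setCongr (hran.trans hran'.symm)).trans (Equiv.ofInjective φ' hφ').symm)
  have hσ : ∀ u, φ' (σ u) = φ u := fun u => Equiv.apply_ofInjective_symm hφ' _
  have hσroot : σ t.root = t'.root :=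
    hφ' (by rw [hσ, (hr _).1 hroot, (hr _).1 hroot'])
  refine ⟨σ, hσroot, ParentTree.map_par_of_map_adj σ hσroot fun u w huw h => ?_⟩
  rw [hadj' _ _ (σ.injective.ne huw), hσ, hσ]
  exact (hadj u w huw).1 h

theorem of_isom {g : CubicGraph n} {ε : Fin (6 * n)} {t t' : ParentTree (2 * n - 1)}
    (h : DeletionCorresponds n g ε t) (ht : t.Isom t') : DeletionCorresponds n g ε t' := by
  obtain ⟨φ, hφ, hran, hroot, hadj⟩ := h
  obtain ⟨σ, hσ, hpar⟩ := ht
  have hpar' : ∀ v, t'.par v = σ (t.par (σ.symm v)) := fun v => by rw [hpar, σ.apply_symm_apply]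
  refine ⟨φ ∘ σ.symm, hφ.comp σ.symm.injective, ?_, ?_, fun u w huw => ?_⟩
  · rw [σ.symm.surjective.range_comp, hran]
  · simpa [← hσ] using hroot
  · rw [Function.comp_apply, Function.comp_apply, ← hadj _ _ (σ.symm.injective.ne huw), hpar',
      hpar', ← Equiv.eq_symm_apply, ← Equiv.eq_symm_apply]

theorem of_iso {g g' : CubicGraph n} {ε ε' : Fin (6 * n)} {t : ParentTree (2 * n - 1)}
    (h : DeletionCorresponds n g ε t) (I : CubicGraph.Iso g g')
    (hI : g'.vert (I.dartEquiv ε) = g'.vert ε') : DeletionCorresponds n g' ε' t := by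
  obtain ⟨φ, hφ, hran, hroot, hadj⟩ := h
  have hNL : ∀ v w, g.NonloopAdj v w ↔ g'.NonloopAdj (I.vertEquiv v) (I.vertEquiv w) := by
    intro v w
    unfold CubicGraph.NonloopAdj CubicGraph.IsLoop
    refine Iff.trans ?_ I.dartEquiv.surjective.exists.symm
    simp [I.map_dinv, I.map_vert]
  rw [I.map_vert] at hI
  refine ⟨I.vertEquiv ∘ φ, I.vertEquiv.injective.comp hφ, ?_, ?_, fun u w huw => ?_⟩
  · rw [Set.range_comp, hran, ← hI]
    ext v
    obtain ⟨v, rfl⟩ := I.vertEquiv.surjective v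
    simp
  · rw [← hI]
    exact (hNL _ _).1 hroot
  · exact (hadj u w huw).trans (hNL _ _)

theorem exists_iso {g g' : CubicGraph n} {ε ε' : Fin (6 * n)} {t : ParentTree (2 * n - 1)}
    (hg : g.OnlyLoopCycles) (hε : g.IsLoop ε) (hg' : g'.OnlyLoopCycles) (hε' : g'.IsLoop ε')
    (h : DeletionCorresponds n g ε t) (h' : DeletionCorresponds n g' ε' t) :
    ∃ I : CubicGraph.Iso g g', I.dartEquiv ε = ε' ∨ I.dartEquiv ε = g'.dinv ε' := by
  classical
  obtain ⟨φ, hφ, hran, hroot, hadj⟩ := h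
  obtain ⟨φ', hφ', hran', hroot', hadj'⟩ := h'
  obtain ⟨r, hr⟩ := hg.existsUnique_nonloopAdj hε
  obtain ⟨r', hr'⟩ := hg'.existsUnique_nonloopAdj hε'
  have hr1 : φ t.root = r := (hr _).1 hroot
  have hr1' : φ' t.root = r' := (hr' _).1 hroot'
  have hsurj : ∀ v, v = g.vert ε ∨ ∃ u, v = φ u := by
    intro v
    by_cases hv : v = g.vert ε
    · exact .inl hv
    · have : v ∈ Set.range φ := hran ▸ hv
      obtain ⟨u, rfl⟩ := this
      exact .inr ⟨u, rfl⟩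
  have hne : ∀ u, φ u ≠ g.vert ε := fun u => by
    have : φ u ∈ {v | v ≠ g.vert ε} := hran ▸ Set.mem_range_self u
    exact this
  have hne' : ∀ u, φ' u ≠ g'.vert ε' := fun u => by
    have : φ' u ∈ {v | v ≠ g'.vert ε'} := hran' ▸ Set.mem_range_self u
    exact this
  have hτ : ∃ τ : Fin (2 * n) ≃ Fin (2 * n), τ (g.vert ε) = g'.vert ε' ∧ ∀ u, τ (φ u) = φ' u := by
    choose f hf using fun v => (hsurj v).elim
      (fun h => (⟨g'.vert ε', .inl ⟨h, rfl⟩⟩ : ∃ w, (v = g.vert ε ∧ w = g'.vert ε') ∨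
        ∃ u, v = φ u ∧ w = φ' u))
      (fun ⟨u, h⟩ => ⟨φ' u, .inr ⟨u, h, rfl⟩⟩)
    have hf0 : f (g.vert ε) = g'.vert ε' := by
      rcases hf (g.vert ε) with h | ⟨u, h, -⟩
      exacts [h.2, absurd h.symm (hne u)]
    have hf1 : ∀ u, f (φ u) = φ' u := fun u => by
      rcases hf (φ u) with h | ⟨w, h, h'⟩
      · exact absurd h.1 (hne u)
      · rw [h', hφ h]
    have hinj : Function.Injective f := by
      intro v w hvw
      rcases hsurj v with rfl | ⟨u, rfl⟩ <;> rcases hsurj w with rfl | ⟨u', rfl⟩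
      · rfl
      · rw [hf0, hf1] at hvw
        exact absurd hvw.symm (hne' _)
      · rw [hf0, hf1] at hvw
        exact absurd hvw (hne' _)
      · rw [hf1, hf1] at hvw
        rw [hφ' hvw]
    exact ⟨Equiv.ofBijective f (Finite.injective_iff_bijective.1 hinj), hf0, hf1⟩
  obtain ⟨τ, hτ0, hτ1⟩ := hτ
  have hNLroot : ∀ w, g.NonloopAdj (g.vert ε) w ↔ g'.NonloopAdj (g'.vert ε') (τ w) := by
    intro w
    rw [hr, hr', ← hr1', ← hτ1, hr1, τ.injective.eq_iff]
  have hcomm : ∀ (g : CubicGraph n) v w, g.NonloopAdj v w ↔ g.NonloopAdj w v :=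
    fun g v w => ⟨fun h => h.symm, fun h => h.symm⟩
  obtain ⟨I, hI⟩ := hg.exists_iso hg' τ fun v w => by
    rcases hsurj v with rfl | ⟨u, rfl⟩
    · rw [hτ0, hNLroot]
    rcases hsurj w with rfl | ⟨u', rfl⟩
    · rw [hτ0, hcomm g, hcomm g', hNLroot]
    by_cases huu : u = u'
    · subst huu
      exact ⟨fun h => absurd rfl h.ne, fun h => absurd rfl h.ne⟩
    · rw [hτ1, hτ1]
      exact (hadj u u' huu).symm.trans (hadj' u u' huu)
  refine ⟨I, g'.eq_or_eq_dinv_of_isLoop hε' ?_ ?_⟩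
  · have : g.vert (g.dinv ε) = g.vert ε := hε
    unfold CubicGraph.IsLoop
    rw [I.map_dinv, I.map_vert, I.map_vert, this]
  · rw [I.map_vert, hI, hτ0]

/-- Deletion is defined on every rooted cubic tree. -/
theorem exists_binary {g : CubicGraph n} {ε : Fin (6 * n)} (hc : g.Connected)
    (hg : g.OnlyLoopCycles) (hε : g.IsLoop ε) :
    ∃ t : ParentTree (2 * n - 1), t.IsBinary ∧ DeletionCorresponds n g ε t := by
  classical
  have : Nonempty (Fin (2 * n)) := ⟨g.vert ε⟩
  obtain ⟨P, h, hP, hadj⟩ := (hc.isTree_toSimple hg).exists_parent_function (g.vert ε)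
  replace hP : ∀ v, v ≠ g.vert ε → g.NonloopAdj v (P v) ∧ h (P v) < h v := hP
  replace hadj : ∀ v w, g.NonloopAdj v w →
    (v ≠ g.vert ε ∧ P v = w) ∨ (w ≠ g.vert ε ∧ P w = v) := hadj
  obtain ⟨r, hr⟩ := hg.existsUnique_nonloopAdj hε
  have hrε : g.NonloopAdj (g.vert ε) r := (hr r).2 rfl
  have e : Fin (2 * n - 1) ≃ {v // v ≠ g.vert ε} :=
    (Fintype.equivFinOfCardEq (by simp)).symm
  have hPr : ∀ v, v ≠ g.vert ε → (P v = g.vert ε ↔ v = r) := by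
    intro v hv
    constructor
    · intro h
      have := (hP v hv).1
      rw [h] at this
      exact (hr v).1 this.symm
    · rintro rfl
      rcases hadj _ _ hrε with h | h
      exacts [absurd rfl h.1, h.2]
  let φ : Fin (2 * n - 1) → Fin (2 * n) := fun u => (e u).1
  have hφ : Function.Injective φ := Subtype.val_injective.comp e.injective
  have hφne : ∀ u, φ u ≠ g.vert ε := fun u => (e u).2
  have hφsurj : ∀ v, v ≠ g.vert ε → ∃ u, φ u = v := fun v hv =>
    ⟨e.symm ⟨v, hv⟩, by simp [φ]⟩
  obtain ⟨root, hroot⟩ := hφsurj r hrε.ne.symm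
  have hpar : ∀ u, ∃ w, (u = root → w = root) ∧ (u ≠ root → φ w = P (φ u)) := by
    intro u
    by_cases hu : u = root
    · exact ⟨root, fun _ => rfl, fun h => absurd hu h⟩
    · have : P (φ u) ≠ g.vert ε := fun h =>
        hu (hφ (((hPr _ (hφne u)).1 h).trans hroot.symm))
      obtain ⟨w, hw⟩ := hφsurj _ this
      exact ⟨w, fun h => absurd h hu, fun _ => hw⟩
  choose par hpar_root hpar_ne using hpar
  have hreach : ∀ v, ∃ k, par^[k] v = root := by
    intro v
    induction hk : h (φ v) using Nat.strong_induction_on generalizing v with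
    | _ k ih =>
      by_cases hv : v = root
      · exact ⟨0, hv⟩
      · obtain ⟨j, hj⟩ := ih (h (φ (par v))) (by
          rw [hpar_ne v hv, ← hk]; exact (hP _ (hφne v)).2) _ rfl
        exact ⟨j + 1, by rwa [Function.iterate_succ_apply]⟩
  have hpar_iff : ∀ u w, w ≠ u → (par w = u ↔ P (φ w) = φ u) := by
    intro u w hwu
    by_cases hw : w = root
    · rw [hpar_root w hw, ← hw]
      refine ⟨fun h => absurd h hwu, fun h => ?_⟩
      rw [(hPr _ (hφne w)).2 (by rw [hw, hroot])] at h
      exact absurd h.symm (hφne u)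
    · rw [← hpar_ne w hw, hφ.eq_iff]
  let t : ParentTree (2 * n - 1) := ⟨par, root, hpar_root root rfl, hreach⟩
  refine ⟨t, fun u => ?_, φ, hφ, ?_, ?_, fun u w huw => ?_⟩
  · have hcard : t.childCount u = ((g.nbrs (φ u)).erase (P (φ u))).card := by
      refine Finset.card_bij (fun w _ => φ w) ?_ (fun _ _ _ _ h => hφ h) ?_
      · intro w hw
        simp only [Finset.mem_filter, Finset.mem_univ, true_and] at hw
        have h1 := (hpar_iff u w hw.2).1 hw.1
        have h2 := hP _ (hφne w)
        have h3 := hP _ (hφne u)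
        rw [h1] at h2
        refine Finset.mem_erase.2 ⟨fun h => ?_, CubicGraph.mem_nbrs.2 h2.1.symm⟩
        rw [← h] at h3
        omega
      · intro v hv
        obtain ⟨hv1, hv2⟩ := Finset.mem_erase.1 hv
        rw [CubicGraph.mem_nbrs] at hv2
        rcases hadj _ _ hv2 with h | ⟨hvε, h⟩
        · exact absurd h.2.symm hv1
        · obtain ⟨w, rfl⟩ := hφsurj v hvε
          have hwu : w ≠ u := fun h => hv2.ne (by rw [h])
          exact ⟨w, by simpa [hwu] using (hpar_iff u w hwu).2 h, rfl⟩
    rw [hcard, Finset.card_erase_of_mem (CubicGraph.mem_nbrs.2 (hP _ (hφne u)).1)]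
    rcases hg.card_nbrs_eq_one_or_three (φ u) with h | h <;> simp [h]
  · ext v
    exact ⟨fun ⟨u, hu⟩ => hu ▸ hφne u, fun hv => hφsurj v hv⟩
  · show g.NonloopAdj _ (φ root)
    rwa [hroot]
  · show par u = w ∨ par w = u ↔ g.NonloopAdj _ _
    rw [hpar_iff _ _ huw, hpar_iff _ _ huw.symm]
    constructor
    · rintro (h | h)
      · exact h ▸ (hP _ (hφne u)).1
      · exact h ▸ (hP _ (hφne w)).1.symm
    · intro h
      exact (hadj _ _ h).imp And.right And.right

end DeletionCorresponds

namespace ParentTree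

variable {m : ℕ}

/-- The darts of the cubic tree built from `t`: two for the edge from each vertex to its parent
(the root being joined to a new vertex), and two for the loop attached to each leaf and to the
new vertex. -/
abbrev CubicDart (t : ParentTree m) : Type :=
  (Fin m × Bool) ⊕ (Option {v // t.childCount v = 0} × Bool)

/-- The base vertex of a dart, where `none` is the vertex added above the root. -/
def cubicVert (t : ParentTree m) : t.CubicDart → Option (Fin m)
  | .inl (v, true) => some v
  | .inl (v, false) => if v = t.root then none else some (t.par v)
  | .inr (l, _) => l.map Subtype.val

/-- The other half of an edge. -/
def cubicInv (t : ParentTree m) : t.CubicDart → t.CubicDart :=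
  Sum.map (Prod.map id not) (Prod.map id not)

theorem card_cubicVert_eq {t : ParentTree m} (ht : t.IsBinary) (v : Option (Fin m)) :
    (Finset.univ.filter fun d => t.cubicVert d = v).card = 3 := by
  rw [Finset.card_filter, Fintype.sum_sum_type, Fintype.sum_prod_type, Fintype.sum_prod_type]
  simp only [Fintype.sum_bool, Fintype.sum_option, Finset.sum_add_distrib]
  cases v with
  | none => simp [cubicVert]
  | some v =>
    have h1 : ∑ u, (if t.cubicVert (.inl (u, false)) = some v then 1 else 0)
        = t.childCount v := by
      rw [childCount, Finset.card_filter]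
      refine Finset.sum_congr rfl fun u _ => ?_
      congr 1
      by_cases hu : u = t.root
      · simp only [cubicVert, hu, if_true, t.par_root, ne_eq, eq_iff_iff]
        simp
      · have := t.par_ne hu
        simp only [cubicVert, hu, if_false, Option.some.injEq, eq_iff_iff, iff_self_and]
        rintro rfl
        exact this.symm
    have h2 : ∑ l : {v // t.childCount v = 0}, (if l.1 = v then 1 else 0)
        = if t.childCount v = 0 then 1 else 0 := by
      rw [← Finset.sum_subtype (Finset.univ.filter fun u => t.childCount u = 0)
        (by simp) (fun u => if u = v then 1 else 0)]
      simp
    rw [h1]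
    simp only [cubicVert, Option.map_some, Option.some.injEq, Option.map_none, h2]
    rcases ht v with h | h <;> simp [h]

theorem cubicInv_cubicInv (t : ParentTree m) (d : t.CubicDart) :
    t.cubicInv (t.cubicInv d) = d := by
  rcases d with ⟨v, b⟩ | ⟨l, b⟩ <;> simp [cubicInv]

theorem cubicInv_ne (t : ParentTree m) (d : t.CubicDart) : t.cubicInv d ≠ d := by
  rcases d with ⟨v, b⟩ | ⟨l, b⟩ <;> simp [cubicInv]

/-- The distance from a vertex to the vertex added above the root. -/
def cubicDepth (t : ParentTree m) : Option (Fin m) → ℕ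
  | none => 0
  | some v => t.depth v + 1

theorem cubicDepth_lt (t : ParentTree m) (v : Fin m) :
    t.cubicDepth (t.cubicVert (.inl (v, false))) < t.cubicDepth (some v) := by
  by_cases hv : v = t.root
  · simp [cubicVert, cubicDepth, hv]
  · simpa [cubicVert, cubicDepth, hv] using t.depth_par_lt hv

/-- A dart which does not lie on a loop and does not point away from the root is the dart
from a vertex to its parent. -/
theorem eq_of_cubicDepth_le (t : ParentTree m) {d : t.CubicDart}
    (hd : t.cubicVert (t.cubicInv d) ≠ t.cubicVert d)
    (h : t.cubicDepth (t.cubicVert (t.cubicInv d)) ≤ t.cubicDepth (t.cubicVert d)) :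
    ∃ v, d = .inl (v, true) ∧ t.cubicVert d = some v := by
  rcases d with ⟨v, _ | _⟩ | ⟨l, b⟩
  · exact absurd h (not_le.2 (t.cubicDepth_lt v))
  · exact ⟨v, rfl, rfl⟩
  · exact absurd rfl hd

theorem exists_cubic {n : ℕ} (hn : 1 ≤ n) {t : ParentTree (2 * n - 1)} (ht : t.IsBinary) :
    ∃ (g : CubicGraph n) (ε : Fin (6 * n)), g.Connected ∧ g.OnlyLoopCycles ∧ g.IsLoop ε ∧
      DeletionCorresponds n g ε t := by
  have hleaf := ht.two_mul_leafCount
  have a : t.CubicDart ≃ Fin (6 * n) := Fintype.equivFinOfCardEq (by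
    have : Fintype.card {v // t.childCount v = 0} = t.leafCount := Fintype.card_subtype _
    simp only [Fintype.card_sum, Fintype.card_prod, Fintype.card_fin, Fintype.card_bool,
      Fintype.card_option, this]
    omega)
  have b : Option (Fin (2 * n - 1)) ≃ Fin (2 * n) := Fintype.equivFinOfCardEq (by
    simp only [Fintype.card_option, Fintype.card_fin]
    omega)
  let g : CubicGraph n :=
    { vert := fun x => b (t.cubicVert (a.symm x))
      dinv := fun x => a (t.cubicInv (a.symm x))
      dinv_invol := fun x => by simp [cubicInv_cubicInv]
      dinv_ne := fun x h => t.cubicInv_ne (a.symm x) (by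
        simpa using congrArg a.symm h)
      regular := fun v => by
        rw [← card_cubicVert_eq ht (b.symm v)]
        refine Finset.card_equiv a.symm fun x => ?_
        simp [Equiv.eq_symm_apply] }
  have hvert : ∀ d, g.vert (a d) = b (t.cubicVert d) := fun d => by simp [g]
  have hdinv : ∀ d, g.dinv (a d) = a (t.cubicInv d) := fun d => by simp [g]
  have hloop : ∀ d, g.IsLoop (a d) ↔ t.cubicVert (t.cubicInv d) = t.cubicVert d := fun d => by
    unfold CubicGraph.IsLoop
    rw [hdinv, hvert, hvert, b.injective.eq_iff]
  have hadj : ∀ v w, g.NonloopAdj (b v) (b w) ↔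
      ∃ d, t.cubicVert (t.cubicInv d) ≠ t.cubicVert d ∧ t.cubicVert d = v ∧
        t.cubicVert (t.cubicInv d) = w := by
    intro v w
    unfold CubicGraph.NonloopAdj
    rw [a.surjective.exists]
    simp only [hloop, hdinv, hvert, b.injective.eq_iff, ne_eq]
  refine ⟨g, a (.inr (none, true)), ?_, ?_, (hloop _).2 rfl, b ∘ some,
    b.injective.comp (Option.some_injective _), ?_, ?_, fun u w huw => ?_⟩
  · let o : Fin (6 * n) := a (.inl (t.root, false))
    have hsymm : ∀ x y, g.Reach x y → g.Reach y x := fun x y h => by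
      induction h with
      | refl => exact .refl
      | tail _ hab ih =>
        refine .head ?_ ih
        rcases hab with hab | rfl
        exacts [.inl hab.symm, .inr (g.dinv_invol _)]
    have hstep : ∀ d d', t.cubicVert d = t.cubicVert d' → g.Reach (a d) (a d') :=
      fun d d' h => .single (.inl (by rw [hvert, hvert, h]))
    have hflip : ∀ d, g.Reach (a d) (a (t.cubicInv d)) := fun d => .single (.inr (hdinv d))
    have hup : ∀ v, g.Reach (a (.inl (v, true))) o := by
      intro v
      induction v using t.induction_par with
      | root => exact hflip _
      | step v hv ih =>
        refine (hflip _).trans ((hstep _ (.inl (t.par v, true)) ?_).trans ih)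
        simp [cubicInv, cubicVert, hv]
    have hall : ∀ x, g.Reach x o := by
      intro x
      obtain ⟨d, rfl⟩ := a.surjective x
      cases hd : t.cubicVert d with
      | none => exact hstep _ _ (hd.trans (by simp [cubicVert]))
      | some v => exact (hstep d (.inl (v, true)) hd).trans (hup v)
    exact fun x y => (hall x).trans (hsymm _ _ (hall y))
  · intro k hk c ⟨hc1, hc2, hc3⟩
    have hk0 : 0 < k := by omega
    have : Nonempty (Fin k) := ⟨⟨0, hk0⟩⟩
    obtain ⟨i, hi⟩ := Finite.exists_max fun i => t.cubicDepth (b.symm (g.vert (c i)))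
    have hnl : ∀ i, ¬ g.IsLoop (c i) := by
      intro i h
      have h1 := congrArg Fin.val (hc2 ((hc1 i).symm.trans h))
      simp only at h1
      have h2 := i.2
      rcases Nat.lt_or_ge (i + 1) k with h | h
      · rw [Nat.mod_eq_of_lt h] at h1
        omega
      · have h : (i : ℕ) + 1 = k := by omega
        rw [h, Nat.mod_self] at h1
        omega
    have hupward : ∀ x, ¬ g.IsLoop x → g.vert x = g.vert (c i) →
        (∃ j, g.vert (g.dinv x) = g.vert (c j)) →
        ∃ v, x = a (.inl (v, true)) ∧ b.symm (g.vert x) = some v := by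
      rintro x hx hxi ⟨j, hj⟩
      obtain ⟨d, rfl⟩ := a.surjective x
      have h := hi j
      simp only [← hj, ← hxi, hdinv, hvert, b.symm_apply_apply] at h
      obtain ⟨v, h1, h2⟩ := t.eq_of_cubicDepth_le ((hloop d).not.1 hx) h
      exact ⟨v, by rw [h1], by rw [hvert, b.symm_apply_apply, h2]⟩
    obtain ⟨j, hj⟩ : ∃ j : Fin k, (⟨(j.1 + 1) % k, Nat.mod_lt _ hk0⟩ : Fin k) = i := by
      by_cases hi0 : i.1 = 0
      · exact ⟨⟨k - 1, by omega⟩, Fin.ext (by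
          simp only [show k - 1 + 1 = k by omega, Nat.mod_self, hi0])⟩
      · exact ⟨⟨i - 1, by omega⟩, Fin.ext (by
          simp only [show (i : ℕ) - 1 + 1 = i by omega, Nat.mod_eq_of_lt i.2])⟩
    have hji : g.vert (g.dinv (c j)) = g.vert (c i) := by rw [hc1, hj]
    obtain ⟨v, hv, hv'⟩ := hupward (c i) (hnl i) rfl ⟨_, hc1 i⟩
    obtain ⟨w, hw, hw'⟩ := hupward (g.dinv (c j)) ((g.isLoop_dinv _).not.2 (hnl j)) hji
      ⟨j, by rw [g.dinv_invol]⟩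
    rw [hji, hv', Option.some.injEq] at hw'
    exact hc3 j i (by rw [hv, hw, hw'])
  · ext v
    obtain ⟨v, rfl⟩ := b.surjective v
    rw [hvert]
    cases v <;> simp [cubicVert]
  · rw [hvert]
    exact (hadj none (some t.root)).2 ⟨.inl (t.root, false), by simp [cubicVert, cubicInv]⟩
  · refine Iff.trans ?_ (hadj (some u) (some w)).symm
    constructor
    · have key : ∀ u w, u ≠ w → t.par u = w → u ≠ t.root := by
        rintro u w huw rfl rfl
        exact huw t.par_root.symm
      rintro (h | h)
      · refine ⟨.inl (u, true), ?_⟩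
        simp [cubicVert, cubicInv, key u w huw h, h, huw.symm]
      · refine ⟨.inl (w, false), ?_⟩
        simp [cubicVert, cubicInv, key w u huw.symm h, h, huw.symm]
    · rintro ⟨⟨v, _ | _⟩ | ⟨l, c⟩, h1, h2, h3⟩
      · by_cases hv : v = t.root <;> simp [cubicVert, cubicInv, hv] at h2 h3
        subst h3
        exact .inr h2
      · by_cases hv : v = t.root <;> simp [cubicVert, cubicInv, hv] at h2 h3
        subst h2
        exact .inl h3
      · exact absurd rfl h1

end ParentTree

/-- Deleting the loops and the edge adjacent to the chosen root loop `ε*`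
induces a bijection between (isomorphism classes of) rooted `(n, n+1)`-cubic trees with a
chosen loop and (isomorphism classes of) rooted binary trees on `2n - 1` vertices with `n`
leaves. -/
theorem rooted_cubic_trees_equiv_binary_trees (n : ℕ) (hn : 1 ≤ n) :
    ∃ E : Quot (@rctIso n) ≃ Quot (@brtIso n),
      ∀ (p : RootedCubicTree n) (t : BinRootedTree n),
        E (Quot.mk _ p) = Quot.mk _ t ↔ DeletionCorresponds n p.1.1 p.1.2 t.1 := by
  have total : ∀ p : RootedCubicTree n,
      ∃ t : BinRootedTree n, DeletionCorresponds n p.1.1 p.1.2 t.1 := by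
    rintro ⟨⟨g, ε⟩, hc, hg, hε⟩
    obtain ⟨t, ht, h⟩ := DeletionCorresponds.exists_binary hc hg hε
    have := ht.two_mul_leafCount
    exact ⟨⟨t, ht, by omega⟩, h⟩
  choose f hf using total
  have resp : ∀ p p', rctIso p p' → (Quot.mk brtIso (f p)) = Quot.mk brtIso (f p') := by
    rintro p p' ⟨I, hI⟩
    refine Quot.sound (DeletionCorresponds.isom p'.2.2.1 p'.2.2.2
      ((hf p).of_iso I ?_) (hf p'))
    rcases hI with h | h <;> rw [h]
    exact p'.2.2.2
  have inv : ∀ (p : RootedCubicTree n) (t t' : BinRootedTree n),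
      Quot.mk brtIso t = Quot.mk brtIso t' →
      DeletionCorresponds n p.1.1 p.1.2 t.1 → DeletionCorresponds n p.1.1 p.1.2 t'.1 := by
    intro p t t' h
    refine (congrArg (Quot.lift (fun t : BinRootedTree n => DeletionCorresponds n p.1.1 p.1.2 t.1)
      fun t t' h => ?_) h).mp
    exact propext ⟨fun hp => hp.of_isom h, fun hp => hp.of_isom h.symm⟩
  have spec : ∀ p t, Quot.mk brtIso (f p) = Quot.mk _ t ↔
      DeletionCorresponds n p.1.1 p.1.2 t.1 := fun p t =>
    ⟨fun h => inv p _ _ h (hf p),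
      fun h => Quot.sound (DeletionCorresponds.isom p.2.2.1 p.2.2.2 (hf p) h)⟩
  refine ⟨Equiv.ofBijective (Quot.lift (fun p => Quot.mk _ (f p)) resp) ⟨?_, ?_⟩, spec⟩
  · rintro ⟨p⟩ ⟨p'⟩ h
    exact Quot.sound (DeletionCorresponds.exists_iso p.2.2.1 p.2.2.2 p'.2.2.1 p'.2.2.2
      ((spec p (f p')).1 h) (hf p'))
  · rintro ⟨t⟩
    obtain ⟨g, ε, hc, hg, hε, h⟩ := ParentTree.exists_cubic hn t.2.1
    exact ⟨Quot.mk _ ⟨(g, ε), hc, hg, hε⟩, (spec _ t).2 h⟩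
end

section
/- Let g be a bridged cubic graph and let ε be an edge of g such that one of the Whitehead moves w_ε^{(1)}(g) or w_ε^{(2)}(g) is bridgeless. Then ε is a bridge of g, and in fact ε is the unique bridge of g. -/
namespace CubicGraph

variable {n : ℕ}

lemma vert_oMax (g : CubicGraph n) (x : Fin (6 * n)) : g.vert (g.oMax x) = g.vert x := by
  have h := (g.othersAt x).max'_mem (g.othersAt_nonempty x)
  exact (Finset.mem_filter.mp (Finset.mem_of_mem_erase h)).2

lemma vert_oMin (g : CubicGraph n) (x : Fin (6 * n)) : g.vert (g.oMin x) = g.vert x := by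
  have h := (g.othersAt x).min'_mem (g.othersAt_nonempty x)
  exact (Finset.mem_filter.mp (Finset.mem_of_mem_erase h)).2

/-- Exchanging a dart at one end of the edge of `x` with a dart at the other end does not
destroy any bridge other than the edge of `x`. -/
lemma IsBridge.swapDarts {g : CubicGraph n} {x y q r : Fin (6 * n)} (hy : g.IsBridge y)
    (hyx : y ≠ x) (hyx' : y ≠ g.dinv x) (hq : g.vert q = g.vert x)
    (hr : g.vert r = g.vert (g.dinv x)) : (g.swapDarts q r).IsBridge y := by
  intro hconn
  refine hy fun d d' => ?_
  have hinv := g.dinv_invol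
  have hxy' : x ≠ g.dinv y := fun h => hyx' (by rw [h, hinv])
  have hxy : g.dinv x ≠ g.dinv y := fun h => hyx (by rw [← hinv y, ← h, hinv])
  have same {a b : Fin (6 * n)} (h : g.vert a = g.vert b) : g.ReachAvoiding y a b :=
    .single (.inl h)
  have hqr : g.ReachAvoiding y q r :=
    (same hq).trans (.trans (.single (.inr ⟨rfl, hyx.symm, hxy'⟩)) (same hr.symm))
  have hrq : g.ReachAvoiding y r q :=
    (same hr).trans (.trans (.single (.inr ⟨hinv x, hyx'.symm, hxy⟩)) (same hq.symm))
  have hswap (a : Fin (6 * n)) : g.ReachAvoiding y a (Equiv.swap q r a) ∧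
      g.ReachAvoiding y (Equiv.swap q r a) a := by
    rw [Equiv.swap_apply_def]
    split_ifs with h₁ h₂
    · exact h₁ ▸ ⟨hqr, hrq⟩
    · exact h₂ ▸ ⟨hrq, hqr⟩
    · exact ⟨.refl, .refl⟩
  have lift : (g.swapDarts q r).ReachAvoiding y d d' → g.ReachAvoiding y d d' := by
    intro h
    induction h with
    | refl => exact .refl
    | @tail a b _ step ih =>
      refine Relation.ReflTransGen.trans ih ?_
      rcases step with h | h
      · exact (hswap a).1.trans ((same h).trans (hswap b).2)
      · exact .single (.inr h)
  exact lift (hconn d d')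

lemma IsBridge.of_dinv {g : CubicGraph n} {x : Fin (6 * n)} (h : g.IsBridge (g.dinv x)) :
    g.IsBridge x := by
  refine fun hconn => h fun d d' => Relation.ReflTransGen.mono (fun a b => ?_) d d' (hconn d d')
  rw [g.dinv_invol]
  tauto

/-- A Whitehead move on the edge of `x` does not destroy any bridge other than that edge. -/
lemma IsBridge.wh {g : CubicGraph n} {x y : Fin (6 * n)} (hy : g.IsBridge y)
    (hyx : y ≠ x) (hyx' : y ≠ g.dinv x) (i : Fin 2) : (g.wh i x).IsBridge y := by
  unfold CubicGraph.wh
  split_ifs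
  · exact hy
  · exact hy.swapDarts hyx hyx' (g.vert_oMax x) (g.vert_oMin _)
  · exact hy.swapDarts hyx hyx' (g.vert_oMax x) (g.vert_oMax _)

end CubicGraph

/-- If `g` is a bridged (connected) cubic graph and some Whitehead move on the
edge of the dart `x` produces a bridgeless graph, then that edge is a bridge of `g`, and in
fact it is the unique bridge of `g`. -/
theorem bridge_of_move_bridgeless (n : ℕ) (g : CubicGraph n) (hg : g.Connected)
    (hb : g.Bridged) (x : Fin (6 * n)) (h : ∃ i : Fin 2, (g.wh i x).Bridgeless) :
    g.IsBridge x ∧ ∀ y, g.IsBridge y → y = x ∨ y = g.dinv x := by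
  obtain ⟨i, hi⟩ := h
  have unique (y : Fin (6 * n)) (hy : g.IsBridge y) : y = x ∨ y = g.dinv x := by
    by_contra! hne
    exact hi y (hy.wh hne.1 hne.2 i)
  refine ⟨?_, unique⟩
  obtain ⟨y, hy⟩ := hb
  rcases unique y hy with rfl | rfl
  · exact hy
  · exact hy.of_dinv
end
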